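/- arXiv:0706.1419 — 2 statements merged into one kernel-verified Lean document; each statement's English description precedes it below -/
import Mathlib

section
/- Let ν be a Borel probability measure on ℝ whose topological support is all of ℝ and which is concentrated on a set of Lebesgue measure zero (i.e., ν(N) = 1 for some Borel set N of Lebesgue measure zero). Then for every x ∈ ℝ, the cluster set of the restriction of G_ν to ℂ⁺ at x equals the closure in ℂ ∪ {∞} of the lower half-plane ℂ⁻. -/
open MeasureTheory Complex Set Filter Topology

noncomputable section

/-- The upper half-plane. -/
def UHP : Set ℂ := {z : ℂ | 0 < z.im}

/-- The lower half-plane. -/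
def LHP : Set ℂ := {z : ℂ | z.im < 0}

/-- The Cauchy transform of a measure on `ℝ`. -/
def cauchyG (ν : Measure ℝ) (z : ℂ) : ℂ := ∫ t : ℝ, (z - (t : ℂ))⁻¹ ∂ν

/-- Cluster set (in `ℂ ∪ {∞}`) at a real point `x` of the restriction of `f` to the
upper half-plane: all limits of sequences `f(zₙ)` with `zₙ ∈ ℂ⁺`, `zₙ → x`. -/
def clusterSetUHP (f : ℂ → ℂ) (x : ℝ) : Set (OnePoint ℂ) :=
  {l | ∃ u : ℕ → ℂ, (∀ n, u n ∈ UHP) ∧ Tendsto u atTop (nhds (x : ℂ)) ∧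
    Tendsto (fun n => (f (u n) : OnePoint ℂ)) atTop (nhds l)}

/-- Rectangle identity when the function is continuous and differentiable off the real line. -/
lemma rect_aux (f : ℂ → ℂ) (z w : ℂ)
    (Hc : ContinuousOn f ((uIcc z.re w.re) ×ℂ (uIcc z.im w.im)))
    (Hd : ∀ ζ ∈ (uIcc z.re w.re) ×ℂ (uIcc z.im w.im), ζ.im ≠ 0 → DifferentiableAt ℂ f ζ) :
    (∫ x : ℝ in z.re..w.re, f (x + z.im * I)) - (∫ x : ℝ in z.re..w.re, f (x + w.im * I)) +
      I • (∫ y : ℝ in z.im..w.im, f (re w + y * I)) -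
      I • (∫ y : ℝ in z.im..w.im, f (re z + y * I)) = 0 := by
  by_cases h0 : (0:ℝ) ∈ (uIcc z.im w.im)
  · have hz0 : (uIcc z.im 0) ⊆ (uIcc z.im w.im) := uIcc_subset_uIcc left_mem_uIcc h0
    have h0w : (uIcc (0:ℝ) w.im) ⊆ (uIcc z.im w.im) := uIcc_subset_uIcc h0 right_mem_uIcc
    have A := integral_boundary_rect_eq_zero_of_continuousOn_of_differentiableOn f z (w.re : ℂ)
      (Hc.mono (by
        intro ζ hζ
        rw [mem_reProdIm] at hζ ⊢
        simp only [ofReal_re, ofReal_im] at hζ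
        exact ⟨hζ.1, hz0 hζ.2⟩))
      (by
        intro ζ hζ
        rw [mem_reProdIm] at hζ
        simp only [ofReal_re, ofReal_im] at hζ
        refine (Hd ζ ?_ ?_).differentiableWithinAt
        · rw [mem_reProdIm]
          exact ⟨Ioo_subset_Icc_self hζ.1, hz0 (Ioo_subset_Icc_self hζ.2)⟩
        · intro h
          rw [h] at hζ
          rcases le_total z.im 0 with h' | h'
          · simp [h'] at hζ
          · simp [h'] at hζ)
    have B := integral_boundary_rect_eq_zero_of_continuousOn_of_differentiableOn f (z.re : ℂ) w
      (Hc.mono (by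
        intro ζ hζ
        rw [mem_reProdIm] at hζ ⊢
        simp only [ofReal_re, ofReal_im] at hζ
        exact ⟨hζ.1, h0w hζ.2⟩))
      (by
        intro ζ hζ
        rw [mem_reProdIm] at hζ
        simp only [ofReal_re, ofReal_im] at hζ
        refine (Hd ζ ?_ ?_).differentiableWithinAt
        · rw [mem_reProdIm]
          exact ⟨Ioo_subset_Icc_self hζ.1, h0w (Ioo_subset_Icc_self hζ.2)⟩
        · intro h
          rw [h] at hζ
          rcases le_total w.im 0 with h' | h'
          · simp [h'] at hζ
          · simp [h'] at hζ)
    simp only [ofReal_re, ofReal_im] at A B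
    have hv : ∀ c ∈ (uIcc z.re w.re), ∀ p q : ℝ, (uIcc p q) ⊆ (uIcc z.im w.im) →
        IntervalIntegrable (fun y : ℝ => f (c + y * I)) volume p q := by
      intro c hc p q hpq
      apply ContinuousOn.intervalIntegrable
      refine Hc.comp (by fun_prop) ?_
      intro y hy
      rw [mem_reProdIm]
      simpa using ⟨hc, hpq hy⟩
    rw [← intervalIntegral.integral_add_adjacent_intervals
        (hv z.re left_mem_uIcc z.im 0 hz0) (hv z.re left_mem_uIcc (0:ℝ) w.im h0w),
      ← intervalIntegral.integral_add_adjacent_intervals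
        (hv w.re right_mem_uIcc z.im 0 hz0) (hv w.re right_mem_uIcc (0:ℝ) w.im h0w)]
    simp only [smul_eq_mul] at A B ⊢
    linear_combination A + B
  · refine integral_boundary_rect_eq_zero_of_differentiableOn f z w ?_
    intro ζ hζ
    refine (Hd ζ hζ ?_).differentiableWithinAt
    intro h
    rw [mem_reProdIm, h] at hζ
    exact h0 hζ.2

lemma painleve (f : ℂ → ℂ) (U : Set ℂ) (hU : IsOpen U) (hc : ContinuousOn f U)
    (hd : ∀ z ∈ U, z.im ≠ 0 → DifferentiableAt ℂ f z) : DifferentiableOn ℂ f U := by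
  refine (isConservativeOn_and_continuousOn_iff_isDifferentiableOn hU).1 ⟨?_, hc⟩
  intro z w hzw
  rw [← add_eq_zero_iff_eq_neg, wedgeIntegral_add_wedgeIntegral_eq]
  exact rect_aux f z w (hc.mono hzw) fun ζ hζ => hd ζ (hzw hζ)

/-- A primitive on a half ball, extended as a globally continuous function. -/
lemma prim_ext (f : ℂ → ℂ) (V : Set ℂ) (hV : Convex ℝ V) (hVo : IsOpen V)
    (hf : DifferentiableOn ℂ f V) (M : ℝ) (hM : ∀ z ∈ V, ‖f z‖ ≤ M) :
    ∃ g : ℂ → ℂ, Continuous g ∧ ∀ z ∈ V, HasDerivAt g (f z) z := by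
  obtain ⟨P, hP⟩ := hV.exists_forall_hasDerivWithinAt hf
  have hlip : LipschitzOnWith M.toNNReal P V := by
    refine hV.lipschitzOnWith_of_nnnorm_hasDerivWithin_le hP ?_
    intro z hz
    rw [← NNReal.coe_le_coe, coe_nnnorm]
    exact (hM z hz).trans (Real.le_coe_toNNReal M)
  obtain ⟨g, hg, hgP⟩ := hlip.extend_finite_dimension
  refine ⟨g, hg.continuous, fun z hz => ?_⟩
  have h1 := (hP z hz).hasDerivAt (hVo.mem_nhds hz)
  refine h1.congr_of_eventuallyEq ?_
  filter_upwards [hVo.mem_nhds hz] with y hy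
  exact (hgP hy).symm

lemma glue (fp fm : ℂ → ℂ) (x r : ℝ) (hr : 0 < r) (M : ℝ)

    (hp : DifferentiableOn ℂ fp (Metric.ball (x:ℂ) r ∩ UHP))
    (hm : DifferentiableOn ℂ fm (Metric.ball (x:ℂ) r ∩ LHP))
    (hpM : ∀ z ∈ Metric.ball (x:ℂ) r ∩ UHP, ‖fp z‖ ≤ M)
    (hmM : ∀ z ∈ Metric.ball (x:ℂ) r ∩ LHP, ‖fm z‖ ≤ M)
    (hL : ∀ a b : ℝ, a ≤ b → x - r < a → b < x + r →
      Tendsto (fun ε : ℝ => ∫ t in a..b, ‖fp (t + ε * I) - fm (t - ε * I)‖) (𝓝[>] 0) (𝓝 0)) :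
    ∃ Φ : ℂ → ℂ, DifferentiableOn ℂ Φ (Metric.ball (x:ℂ) r) ∧
      (∀ z ∈ Metric.ball (x:ℂ) r ∩ UHP, Φ z = fp z) ∧
      (∀ z ∈ Metric.ball (x:ℂ) r ∩ LHP, Φ z = fm z) := by
  have hUo : IsOpen UHP := isOpen_lt continuous_const continuous_im
  have hLo : IsOpen LHP := isOpen_lt continuous_im continuous_const
  have hUc : Convex ℝ UHP := convex_halfSpace_im_gt 0
  have hLc : Convex ℝ LHP := convex_halfSpace_im_lt 0
  obtain ⟨gp, hgpc, hgp⟩ := prim_ext fp _ ((convex_ball _ _).inter hUc)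
    (Metric.isOpen_ball.inter hUo) hp M hpM
  obtain ⟨gm, hgmc, hgm⟩ := prim_ext fm _ ((convex_ball _ _).inter hLc)
    (Metric.isOpen_ball.inter hLo) hm M hmM
  -- the jump is constant
  have key : ∀ a b : ℝ, a ≤ b → x - r < a → b < x + r →
      gp b - gm b - (gp a - gm a) = 0 := by
    intro a b hab ha hb
    have lim1 : Tendsto (fun ε : ℝ => gp (b + ε * I) - gm (b - ε * I)
        - (gp (a + ε * I) - gm (a - ε * I))) (𝓝[>] 0) (𝓝 (gp b - gm b - (gp a - gm a))) := by
      have hcont : Continuous (fun ε : ℝ => gp (b + ε * I) - gm (b - ε * I)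
        - (gp (a + ε * I) - gm (a - ε * I))) := by fun_prop
      have := hcont.tendsto 0
      simp only [ofReal_zero, zero_mul, add_zero, sub_zero] at this
      exact this.mono_left nhdsWithin_le_nhds
    have lim2 : Tendsto (fun ε : ℝ => gp (b + ε * I) - gm (b - ε * I)
        - (gp (a + ε * I) - gm (a - ε * I))) (𝓝[>] 0) (𝓝 0) := by
      refine squeeze_zero_norm' ?_ (hL a b hab ha hb)
      obtain ⟨m, hm0, hm1⟩ : ∃ m, 0 < m ∧ ∀ t ∈ Icc a b, |t - x| + m < r := by
        refine ⟨min (a - (x - r)) (x + r - b) / 2, by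
          have := sub_pos.2 ha
          have := sub_pos.2 hb
          positivity, ?_⟩
        intro t ht
        have h1 := min_le_left (a - (x - r)) (x + r - b)
        have h2 := min_le_right (a - (x - r)) (x + r - b)
        have h3 : 0 < min (a - (x - r)) (x + r - b) := lt_min (sub_pos.2 ha) (sub_pos.2 hb)
        rcases abs_cases (t - x) with ⟨h, _⟩ | ⟨h, _⟩ <;> rw [h] <;> linarith [ht.1, ht.2]
      filter_upwards [Ioo_mem_nhdsGT hm0] with ε hε
      have memp : ∀ t ∈ Icc a b, (t + ε * I : ℂ) ∈ Metric.ball (x:ℂ) r ∩ UHP := by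
        intro t ht
        refine ⟨?_, by simpa [UHP] using hε.1⟩
        rw [Metric.mem_ball, dist_eq_norm]
        have : (t + ε * I - x : ℂ) = ((t - x : ℝ) : ℂ) + ε * I := by push_cast; ring
        rw [this]
        refine (norm_add_le _ _).trans_lt ?_
        rw [norm_mul, norm_I, mul_one, norm_real, norm_real, Real.norm_eq_abs, Real.norm_eq_abs,
          abs_of_pos hε.1]
        linarith [hm1 t ht, hε.2]
      have memm : ∀ t ∈ Icc a b, (t - ε * I : ℂ) ∈ Metric.ball (x:ℂ) r ∩ LHP := by
        intro t ht
        refine ⟨?_, by simpa [LHP] using hε.1⟩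
        rw [Metric.mem_ball, dist_eq_norm]
        have : (t - ε * I - x : ℂ) = ((t - x : ℝ) : ℂ) - ε * I := by push_cast; ring
        rw [this]
        refine (norm_sub_le _ _).trans_lt ?_
        rw [norm_mul, norm_I, mul_one, norm_real, norm_real, Real.norm_eq_abs, Real.norm_eq_abs,
          abs_of_pos hε.1]
        linarith [hm1 t ht, hε.2]
      have hder : ∀ t ∈ uIcc a b, HasDerivAt (fun t : ℝ => gp (t + ε * I) - gm (t - ε * I))
          (fp (t + ε * I) - fm (t - ε * I)) t := by
        intro t ht
        rw [uIcc_of_le hab] at ht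
        have e1 : HasDerivAt (fun t : ℝ => (t + ε * I : ℂ)) 1 t :=
          (Complex.ofRealCLM.hasDerivAt (x := t)).add_const _
        have e2 : HasDerivAt (fun t : ℝ => (t - ε * I : ℂ)) 1 t :=
          (Complex.ofRealCLM.hasDerivAt (x := t)).sub_const _
        have h1 := (hgp _ (memp t ht)).comp t e1
        have h2 := (hgm _ (memm t ht)).comp t e2
        have h3 := h1.sub h2
        simp only [mul_one] at h3
        exact h3
      have hint : IntervalIntegrable (fun t : ℝ => fp (t + ε * I) - fm (t - ε * I)) volume a b := by
        apply ContinuousOn.intervalIntegrable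
        rw [uIcc_of_le hab]
        exact (hp.continuousOn.comp (by fun_prop) memp).sub
          (hm.continuousOn.comp (by fun_prop) memm)
      rw [← intervalIntegral.integral_eq_sub_of_hasDerivAt hder hint]
      exact intervalIntegral.norm_integral_le_integral_norm hab
    exact tendsto_nhds_unique lim1 lim2
  set c : ℂ := gp x - gm x with hc
  have hjump : ∀ t : ℝ, |t - x| < r → gp t = gm t + c := by
    intro t ht
    rw [abs_lt] at ht
    rcases le_total t x with h | h
    · have := key t x h (by linarith) (by linarith)
      linear_combination -this
    · have := key x t h (by linarith) (by linarith)
      linear_combination this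
  let Θ : ℂ → ℂ := fun z => if 0 ≤ z.im then gp z else gm z + c
  have hΘp : ∀ z : ℂ, 0 < z.im → Θ =ᶠ[𝓝 z] gp := by
    intro z hz
    filter_upwards [hUo.mem_nhds hz] with y hy
    have : 0 < y.im := hy
    simp [Θ, this.le]
  have hΘm : ∀ z : ℂ, z.im < 0 → Θ =ᶠ[𝓝 z] fun z => gm z + c := by
    intro z hz
    filter_upwards [hLo.mem_nhds hz] with y hy
    have : y.im < 0 := hy
    simp [Θ, this]
  have hΘpd : ∀ z ∈ Metric.ball (x:ℂ) r ∩ UHP, HasDerivAt Θ (fp z) z := fun z hz =>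
    (hgp z hz).congr_of_eventuallyEq (hΘp z hz.2)
  have hΘmd : ∀ z ∈ Metric.ball (x:ℂ) r ∩ LHP, HasDerivAt Θ (fm z) z := fun z hz =>
    ((hgm z hz).add_const c).congr_of_eventuallyEq (hΘm z hz.2)
  have hΘc : ContinuousOn Θ (Metric.ball (x:ℂ) r) := by
    intro z hz
    apply ContinuousAt.continuousWithinAt
    rcases lt_trichotomy z.im 0 with h | h | h
    · exact (hΘmd z ⟨hz, h⟩).continuousAt
    · have hzt : z = (z.re : ℂ) := by apply Complex.ext <;> simp [h]
      have hj : gp z = gm z + c := by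
        rw [hzt]
        apply hjump
        rw [Metric.mem_ball, dist_eq_norm, hzt, ← ofReal_sub, norm_real] at hz
        exact hz
      have hv : Θ z = gp z := by simp [Θ, h]
      rw [ContinuousAt, hv]
      refine Tendsto.if' (l₁ := 𝓝 z) (hgpc.tendsto z) ?_
      rw [hj]
      exact (hgmc.tendsto z).add_const c
    · exact (hΘpd z ⟨hz, h⟩).continuousAt
  have hΘd := painleve Θ _ Metric.isOpen_ball hΘc (by
    intro z hz h
    rcases lt_or_gt_of_ne h with h | h
    · exact (hΘmd z ⟨hz, h⟩).differentiableAt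
    · exact (hΘpd z ⟨hz, h⟩).differentiableAt)
  refine ⟨deriv Θ, hΘd.deriv Metric.isOpen_ball, fun z hz => (hΘpd z hz).deriv,
    fun z hz => (hΘmd z hz).deriv⟩

lemma norm_sub_ofReal_ge (z : ℂ) (t : ℝ) : |z.im| ≤ ‖z - t‖ := by
  have := Complex.abs_im_le_norm (z - t)
  simpa using this

lemma sub_ofReal_ne {z : ℂ} (hz : 0 < z.im) (t : ℝ) : z - t ≠ 0 := by
  intro h
  have := congrArg Complex.im h
  simp at this
  linarith

lemma norm_inv_le {z : ℂ} (hz : 0 < z.im) (t : ℝ) : ‖(z - (t:ℂ))⁻¹‖ ≤ z.im⁻¹ := by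
  rw [norm_inv]
  have := norm_sub_ofReal_ge z t
  rw [abs_of_pos hz] at this
  exact inv_anti₀ hz this

lemma cont_kernel {z : ℂ} (hz : 0 < z.im) : Continuous (fun t : ℝ => (z - (t:ℂ))⁻¹) := by
  refine Continuous.inv₀ (by fun_prop) (fun t => sub_ofReal_ne hz t)

lemma integrable_kernel (ν : Measure ℝ) [IsProbabilityMeasure ν] {z : ℂ} (hz : 0 < z.im) :
    Integrable (fun t : ℝ => (z - (t:ℂ))⁻¹) ν :=
  Integrable.of_bound (cont_kernel hz).aestronglyMeasurable z.im⁻¹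
    (ae_of_all _ fun t => norm_inv_le hz t)

lemma im_kernel (z : ℂ) (t : ℝ) :
    ((z - (t:ℂ))⁻¹).im = -(z.im / ((z.re - t) ^ 2 + z.im ^ 2)) := by
  rw [Complex.inv_im, Complex.normSq_apply]
  simp
  ring

lemma integrable_pois (ν : Measure ℝ) [IsProbabilityMeasure ν] {z : ℂ} (hz : 0 < z.im) :
    Integrable (fun t : ℝ => z.im / ((z.re - t) ^ 2 + z.im ^ 2)) ν := by
  have := (integrable_kernel ν hz).im.neg
  refine this.congr (ae_of_all _ fun t => ?_)
  change -((z - (t:ℂ))⁻¹).im = _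
  rw [im_kernel, neg_neg]

lemma neg_im_G (ν : Measure ℝ) [IsProbabilityMeasure ν] {z : ℂ} (hz : 0 < z.im) :
    -(cauchyG ν z).im = ∫ t : ℝ, z.im / ((z.re - t) ^ 2 + z.im ^ 2) ∂ν := by
  have h : (cauchyG ν z).im = ∫ t : ℝ, ((z - (t:ℂ))⁻¹).im ∂ν :=
    (Complex.imCLM.integral_comp_comm (integrable_kernel ν hz)).symm
  rw [h, ← integral_neg]
  simp_rw [im_kernel, neg_neg]

lemma im_G_neg (ν : Measure ℝ) [IsProbabilityMeasure ν] {z : ℂ} (hz : 0 < z.im) :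
    (cauchyG ν z).im < 0 := by
  have h := neg_im_G ν hz
  have hpos : ∀ t : ℝ, 0 < z.im / ((z.re - t) ^ 2 + z.im ^ 2) := fun t => by positivity
  have : 0 < ∫ t : ℝ, z.im / ((z.re - t) ^ 2 + z.im ^ 2) ∂ν := by
    rw [integral_pos_iff_support_of_nonneg (fun t => (hpos t).le) (integrable_pois ν hz)]
    have : Function.support (fun t : ℝ => z.im / ((z.re - t) ^ 2 + z.im ^ 2)) = univ := by
      ext t
      simp only [Function.mem_support, mem_univ, iff_true]
      exact (hpos t).ne'
    rw [this]
    simp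
  linarith

lemma diff_G (ν : Measure ℝ) [IsProbabilityMeasure ν] : DifferentiableOn ℂ (cauchyG ν) UHP := by
  intro z hz
  have hz' : 0 < z.im := hz
  apply DifferentiableAt.differentiableWithinAt
  have hball : ∀ w ∈ Metric.ball z (z.im / 2), z.im / 2 < w.im := by
    intro w hw
    rw [Metric.mem_ball, dist_eq_norm] at hw
    have := (Complex.abs_im_le_norm (w - z)).trans_lt hw
    rw [abs_lt, sub_im] at this
    linarith [this.1]
  have := hasDerivAt_integral_of_dominated_loc_of_deriv_le (μ := ν) (𝕜 := ℂ)
    (F := fun (w : ℂ) (t : ℝ) => (w - (t:ℂ))⁻¹) (F' := fun (w : ℂ) (t : ℝ) => -1 / (w - (t:ℂ)) ^ 2)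
    (x₀ := z) (s := Metric.ball z (z.im / 2)) (bound := fun _ => ((z.im / 2)⁻¹) ^ 2)
    (Metric.ball_mem_nhds z (by positivity)) ?_ (integrable_kernel ν hz') ?_ ?_
    (integrable_const _) ?_
  · exact this.2.differentiableAt
  · filter_upwards [Metric.ball_mem_nhds z (half_pos hz')] with w hw
    exact (cont_kernel (by linarith [hball w hw])).aestronglyMeasurable
  · apply Continuous.aestronglyMeasurable
    refine continuous_const.div (by fun_prop) fun t => ?_
    exact pow_ne_zero 2 (sub_ofReal_ne hz' t)
  · refine ae_of_all _ fun t w hw => ?_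
    have h1 := hball w hw
    have h2 : ‖(w - (t:ℂ))⁻¹‖ ≤ (z.im / 2)⁻¹ :=
      (norm_inv_le (by linarith) t).trans (inv_anti₀ (by linarith) h1.le)
    rw [norm_div, norm_neg, norm_one, norm_pow, one_div, ← inv_pow, ← norm_inv]
    exact pow_le_pow_left₀ (norm_nonneg _) h2 2
  · refine ae_of_all _ fun t w hw => ?_
    have h1 := hball w hw
    have hw0 : w - (t:ℂ) ≠ 0 := sub_ofReal_ne (by linarith) t
    exact ((hasDerivAt_id' w).sub_const (t:ℂ)).inv hw0

/-- The mass at a non-atom. -/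
lemma mass_lim (ν : Measure ℝ) [IsProbabilityMeasure ν] (t : ℝ) (ht : ν {t} = 0) :
    Tendsto (fun y : ℝ => (y : ℂ) * cauchyG ν (t + y * I)) (𝓝[>] 0) (𝓝 0) := by
  have h : ∀ y : ℝ, (y : ℂ) * cauchyG ν (t + y * I)
      = ∫ s : ℝ, (y : ℂ) * (t + y * I - (s:ℂ))⁻¹ ∂ν := by
    intro y
    rw [integral_const_mul]; rfl
  simp_rw [h]
  have h0 : (0:ℂ) = ∫ s : ℝ, (0:ℂ) ∂ν := by simp
  rw [h0]
  refine tendsto_integral_filter_of_dominated_convergence (fun _ => (1:ℝ)) ?_ ?_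
    (integrable_const _) ?_
  · filter_upwards [self_mem_nhdsWithin] with y hy
    have hy' : 0 < ((t:ℂ) + y * I).im := by simpa using hy
    exact ((cont_kernel hy').const_smul (y:ℂ)).aestronglyMeasurable
  · filter_upwards [self_mem_nhdsWithin] with y hy
    have hy0 : 0 < y := hy
    have hy' : 0 < ((t:ℂ) + y * I).im := by simpa using hy
    refine ae_of_all _ fun s => ?_
    have := norm_inv_le hy' s
    rw [norm_mul, norm_real, Real.norm_eq_abs, abs_of_pos hy0]
    have h2 : ((t:ℂ) + y * I).im = y := by simp
    rw [h2] at this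
    calc y * ‖((t:ℂ) + y * I - s)⁻¹‖ ≤ y * y⁻¹ := by gcongr
      _ = 1 := mul_inv_cancel₀ hy0.ne'
  · have hae : ∀ᵐ s ∂ν, s ≠ t := by
      rw [ae_iff]
      simpa using ht
    filter_upwards [hae] with s hs
    have hne : (t:ℂ) + (0:ℝ) * I - s ≠ 0 := by
      simp only [ofReal_zero, zero_mul, add_zero]
      rw [sub_ne_zero]
      exact_mod_cast hs.symm
    have hc : ContinuousAt (fun y : ℝ => (y : ℂ) * (t + y * I - (s:ℂ))⁻¹) 0 := by
      refine ContinuousAt.mul (by fun_prop) (ContinuousAt.inv₀ (by fun_prop) hne)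
    have := hc.tendsto
    simp only [ofReal_zero, zero_mul] at this
    exact this.mono_left nhdsWithin_le_nhds

/-- quadratic bound implies no mass -/
lemma no_mass (ν : Measure ℝ) [IsProbabilityMeasure ν] (C p q : ℝ) 
    (h : ∀ s t, p ≤ s → s ≤ t → t ≤ q → ν.real (Icc s t) ≤ C * (t - s) ^ 2) (hpq : p ≤ q) :
    ν.real (Icc p q) = 0 := by
  have hn : ∀ n : ℕ, ∀ s t, p ≤ s → s ≤ t → t ≤ q →
      ν.real (Icc s t) ≤ C * (t - s) ^ 2 * (1 / 2) ^ n := by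
    intro n
    induction n with
    | zero => simpa using h
    | succ n ih =>
      intro s t hs hst ht
      have h1 := ih s ((s + t) / 2) hs (by linarith) (by linarith)
      have h2 := ih ((s + t) / 2) t (by linarith) (by linarith) ht
      have h3 : ν.real (Icc s t) ≤ ν.real (Icc s ((s + t) / 2)) + ν.real (Icc ((s + t) / 2) t) := by
        rw [← Icc_union_Icc_eq_Icc (b := (s + t) / 2) (by linarith) (by linarith)]
        exact measureReal_union_le _ _
      calc _ ≤ _ := h3
        _ ≤ _ := add_le_add h1 h2
        _ = _ := by ring
  have hlim : Tendsto (fun n : ℕ => C * (q - p) ^ 2 * (1 / 2 : ℝ) ^ n) atTop (𝓝 0) := by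
    have := (tendsto_pow_atTop_nhds_zero_of_lt_one (r := (1/2:ℝ)) (by norm_num)
      (by norm_num)).const_mul (C * (q - p) ^ 2)
    simpa using this
  exact le_antisymm (ge_of_tendsto' hlim fun n => hn n p q le_rfl hpq le_rfl) measureReal_nonneg

lemma no_linear (ν : Measure ℝ) [IsProbabilityMeasure ν]
    (hsupp : ∀ x : ℝ, ∀ ε > 0, 0 < ν (Set.Ioo (x - ε) (x + ε)))
    (t₀ y C : ℝ) (hy : 0 < y)
    (h : ∀ z ∈ Metric.ball (t₀:ℂ) y ∩ UHP, -(cauchyG ν z).im ≤ C * z.im) : False := by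
  have hz := no_mass ν (C / 2) (t₀ - y / 4) (t₀ + y / 4) ?_ (by linarith)
  · have h1 := hsupp t₀ (y / 4) (by positivity)
    have h2 : ν (Icc (t₀ - y / 4) (t₀ + y / 4)) = 0 := by
      rwa [measureReal_eq_zero_iff] at hz
    exact h1.ne' (measure_mono_null Ioo_subset_Icc_self h2)
  · intro s t hs hst ht
    rcases hst.eq_or_lt with rfl | hst
    · -- a point: use small h
      have hq : ∀ k : ℝ, 0 < k → k < y / 4 → ν.real (Icc s s) ≤ C * k ^ 2 := by
        intro k hk hky
        have hk' : 0 < ((s:ℂ) + k * I).im := by simpa using hk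
        have h3 := h (s + k * I) ⟨?_, hk'⟩
        · rw [neg_im_G ν hk'] at h3
          simp at h3
          have h4 : ∫ r in Icc s s, k / ((s - r) ^ 2 + k ^ 2) ∂ν
              ≤ ∫ r, k / ((s - r) ^ 2 + k ^ 2) ∂ν := by
            have hi := integrable_pois ν hk'
            simp at hi
            exact setIntegral_le_integral hi (ae_of_all _ fun r => by positivity)
          rw [Icc_self, integral_singleton] at h4
          simp at h4
          rw [Icc_self]
          have h5 : k / k ^ 2 = k⁻¹ := by field_simp
          rw [h5] at h4
          have h6 := h4.trans h3
          have h7 : ν.real {s} = (ν.real {s} * k⁻¹) * k := by field_simp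
          rw [h7]
          nlinarith
        · rw [Metric.mem_ball, dist_eq_norm]
          have : (s + k * I - t₀ : ℂ) = ((s - t₀ : ℝ) : ℂ) + k * I := by push_cast; ring
          rw [this]
          refine (norm_add_le _ _).trans_lt ?_
          rw [norm_mul, norm_I, mul_one, norm_real, norm_real, Real.norm_eq_abs, Real.norm_eq_abs,
            abs_of_pos hk]
          rcases abs_cases (s - t₀) with ⟨h, _⟩ | ⟨h, _⟩ <;> rw [h] <;> linarith
      have hlim : Tendsto (fun k : ℝ => C * k ^ 2) (𝓝[>] 0) (𝓝 0) := by
        have : Continuous (fun k : ℝ => C * k ^ 2) := by fun_prop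
        have := this.tendsto 0
        simp at this
        exact this.mono_left nhdsWithin_le_nhds
      have := ge_of_tendsto hlim (b := ν.real (Icc s s)) (by
        filter_upwards [Ioo_mem_nhdsGT (show (0:ℝ) < y / 4 by positivity)] with k hk
        exact hq k hk.1 hk.2)
      simpa using this
    · set k := (t - s) / 2 with hk
      set c := (s + t) / 2 with hcdef
      have hk0 : 0 < k := by rw [hk]; linarith
      have hk' : 0 < ((c:ℂ) + k * I).im := by simpa using hk0
      have h3 := h (c + k * I) ⟨?_, hk'⟩
      · rw [neg_im_G ν hk'] at h3
        simp at h3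
        have hi := integrable_pois ν hk'
        simp at hi
        have h4 : ∫ r in Icc s t, k / ((c - r) ^ 2 + k ^ 2) ∂ν
            ≤ ∫ r, k / ((c - r) ^ 2 + k ^ 2) ∂ν :=
          setIntegral_le_integral hi (ae_of_all _ fun r => by positivity)
        have h5 : ∫ r in Icc s t, (2 * k)⁻¹ ∂ν ≤ ∫ r in Icc s t, k / ((c - r) ^ 2 + k ^ 2) ∂ν := by
          refine setIntegral_mono_on (integrable_const _).integrableOn hi.integrableOn
            measurableSet_Icc ?_
          intro r hr
          rw [inv_eq_one_div, div_le_div_iff₀ (by positivity) (by positivity)]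
          have : (c - r) ^ 2 ≤ k ^ 2 := by
            apply sq_le_sq'
            · rw [hk, hcdef]; linarith [hr.1, hr.2]
            · rw [hk, hcdef]; linarith [hr.1, hr.2]
          nlinarith
        rw [setIntegral_const, smul_eq_mul] at h5
        have h6 := (h5.trans h4).trans h3
        have h7 : ν.real (Icc s t) = (ν.real (Icc s t) * (2 * k)⁻¹) * (2 * k) := by field_simp
        rw [h7]
        calc _ ≤ C * k * (2 * k) := by gcongr
          _ = _ := by rw [hk]; ring
      · rw [Metric.mem_ball, dist_eq_norm]
        have : (c + k * I - t₀ : ℂ) = ((c - t₀ : ℝ) : ℂ) + k * I := by push_cast; ring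
        rw [this]
        refine (norm_add_le _ _).trans_lt ?_
        rw [norm_mul, norm_I, mul_one, norm_real, norm_real, Real.norm_eq_abs, Real.norm_eq_abs,
          abs_of_pos hk0]
        rcases abs_cases (c - t₀) with ⟨h, _⟩ | ⟨h, _⟩ <;> rw [h, hk] <;> linarith

lemma pois_lint {ε : ℝ} (hε : 0 < ε) (s : ℝ) :
    ∫⁻ t : ℝ, ENNReal.ofReal (ε / ((t - s) ^ 2 + ε ^ 2)) = ENNReal.ofReal Real.pi := by
  have h := ProbabilityTheory.lintegral_cauchyPDF_eq_one s (γ := ε.toNNReal)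
    (by simpa using hε)
  have h2 : ∀ t : ℝ, ENNReal.ofReal (ε / ((t - s) ^ 2 + ε ^ 2))
      = ENNReal.ofReal Real.pi * ProbabilityTheory.cauchyPDF s ε.toNNReal t := by
    intro t
    unfold ProbabilityTheory.cauchyPDF
    rw [← ENNReal.ofReal_mul Real.pi_pos.le,
      ProbabilityTheory.cauchyPDFReal_def, Real.coe_toNNReal ε hε.le]
    congr 1
    have := Real.pi_pos
    field_simp
  simp_rw [h2]
  rw [lintegral_const_mul _ (ProbabilityTheory.measurable_cauchyPDF _ _), h, mul_one]

lemma lint_conv (ν : Measure ℝ) [IsProbabilityMeasure ν]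
    (hnull : ∃ N : Set ℝ, MeasurableSet N ∧ volume N = 0 ∧ ν N = 1) (a b : ℝ) :
    Tendsto (fun ε : ℝ => ∫⁻ t in Ioc a b,
      min 1 (∫⁻ s, ENNReal.ofReal (ε / ((t - s) ^ 2 + ε ^ 2)) ∂ν)) (𝓝[>] 0) (𝓝 0) := by
  obtain ⟨N, hNm, hN0, hN1⟩ := hnull
  have hNc : ν Nᶜ = 0 := by rw [prob_compl_eq_zero_iff hNm]; exact hN1
  rw [ENNReal.tendsto_nhds_zero]
  intro e he
  obtain ⟨q, hq0, hqe⟩ := ENNReal.lt_iff_exists_nnreal_btwn.1 he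
  have hq0' : (0:ℝ) < q := by exact_mod_cast hq0
  set η : ℝ := q / (2 + Real.pi) with hη
  have hpi := Real.pi_pos
  have hη0 : 0 < η := by positivity
  have hsum : ENNReal.ofReal η + ENNReal.ofReal η + ENNReal.ofReal Real.pi * ENNReal.ofReal η ≤ e := by
    rw [← ENNReal.ofReal_mul hpi.le, ← ENNReal.ofReal_add hη0.le hη0.le,
      ← ENNReal.ofReal_add (by positivity) (by positivity)]
    have : η + η + Real.pi * η = q := by rw [hη]; field_simp; ring
    rw [this, ENNReal.ofReal_coe_nnreal]
    exact hqe.le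
  obtain ⟨K, hKN, hKc, hKlt⟩ := hNm.exists_isCompact_sdiff_lt (μ := ν) (measure_ne_top _ _)
    (ε := ENNReal.ofReal η) (by simpa using hη0)
  have hKν : ν Kᶜ ≤ ENNReal.ofReal η := by
    have : Kᶜ ⊆ (N \ K) ∪ Nᶜ := by
      intro y hy
      by_cases h : y ∈ N
      · exact Or.inl ⟨h, hy⟩
      · exact Or.inr h
    calc ν Kᶜ ≤ ν (N \ K) + ν Nᶜ := (measure_mono this).trans (measure_union_le _ _)
      _ ≤ _ := by rw [hNc, add_zero]; exact hKlt.le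
  have hK0 : volume K = 0 := measure_mono_null hKN hN0
  have hKm : MeasurableSet K := hKc.measurableSet
  obtain ⟨δ, hδ0, hδ⟩ : ∃ δ > 0, volume (Metric.cthickening δ K) ≤ ENNReal.ofReal η := by
    have h1 := (tendsto_measure_cthickening_of_isCompact (μ := (volume : Measure ℝ)) hKc)
    rw [hK0, ENNReal.tendsto_nhds_zero] at h1
    have h2 := h1 (ENNReal.ofReal η) (by simpa using hη0)
    have h3 : ∀ᶠ r in 𝓝[>] (0:ℝ), volume (Metric.cthickening r K) ≤ ENNReal.ofReal η :=
      h2.filter_mono nhdsWithin_le_nhds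
    obtain ⟨δ, hd1, hd2⟩ := (h3.and self_mem_nhdsWithin).exists
    exact ⟨δ, hd2, hd1⟩
  set T := Metric.cthickening δ K with hT
  have hTm : MeasurableSet T := Metric.isClosed_cthickening.measurableSet
  -- small ε
  have hev : ∀ᶠ ε in 𝓝[>] (0:ℝ), ENNReal.ofReal (ε / δ ^ 2) * volume (Ioc a b)
      ≤ ENNReal.ofReal η := by
    have hc : Tendsto (fun ε : ℝ => ε / δ ^ 2 * (max (b - a) 0)) (𝓝[>] 0) (𝓝 0) := by
      have : Continuous (fun ε : ℝ => ε / δ ^ 2 * (max (b - a) 0)) := by fun_prop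
      have := this.tendsto 0
      simp only [zero_div, zero_mul] at this
      exact this.mono_left nhdsWithin_le_nhds
    filter_upwards [hc.eventually_le_const hη0, self_mem_nhdsWithin] with ε h1 h2
    have h2' : 0 < ε := h2
    rw [Real.volume_Ioc, ← ENNReal.ofReal_mul (by positivity)]
    apply ENNReal.ofReal_le_ofReal
    refine le_trans ?_ h1
    gcongr
    exact le_max_left _ _
  filter_upwards [hev, self_mem_nhdsWithin] with ε hε1 hε
  have hε0 : 0 < ε := hε
  have hmeas : Measurable (Function.uncurry fun t s : ℝ =>
      ENNReal.ofReal (ε / ((t - s) ^ 2 + ε ^ 2))) := by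
    unfold Function.uncurry
    fun_prop
  refine le_trans ?_ hsum
  calc ∫⁻ t in Ioc a b, min 1 (∫⁻ s, ENNReal.ofReal (ε / ((t - s) ^ 2 + ε ^ 2)) ∂ν)
      ≤ ∫⁻ t in Ioc a b, ((T.indicator 1 t + ENNReal.ofReal (ε / δ ^ 2))
          + ∫⁻ s in Kᶜ, ENNReal.ofReal (ε / ((t - s) ^ 2 + ε ^ 2)) ∂ν) := by
        refine lintegral_mono fun t => ?_
        by_cases ht : t ∈ T
        · refine (min_le_left _ _).trans ?_
          simp only [ht, indicator_of_mem, Pi.one_apply]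
          rw [add_assoc]
          exact le_self_add
        · refine (min_le_right _ _).trans ?_
          simp only [ht, not_false_eq_true, indicator_of_notMem, zero_add]
          rw [← lintegral_add_compl _ hKm]
          gcongr
          calc ∫⁻ s in K, ENNReal.ofReal (ε / ((t - s) ^ 2 + ε ^ 2)) ∂ν
              ≤ ∫⁻ s in K, ENNReal.ofReal (ε / δ ^ 2) ∂ν := by
                refine setLIntegral_mono measurable_const fun s hs => ?_
                apply ENNReal.ofReal_le_ofReal
                have hd : δ < dist t s := by
                  by_contra hcon
                  exact ht (Metric.mem_cthickening_of_dist_le t s δ K hs (not_lt.1 hcon))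
                rw [Real.dist_eq] at hd
                have : δ ^ 2 ≤ (t - s) ^ 2 := by
                  rw [← sq_abs (t - s)]
                  exact pow_le_pow_left₀ hδ0.le hd.le 2
                gcongr
                nlinarith
            _ = ENNReal.ofReal (ε / δ ^ 2) * ν K := by rw [setLIntegral_const]
            _ ≤ ENNReal.ofReal (ε / δ ^ 2) * 1 := by gcongr; exact prob_le_one
            _ = _ := mul_one _
    _ = (∫⁻ t in Ioc a b, T.indicator 1 t + ENNReal.ofReal (ε / δ ^ 2))
          + ∫⁻ t in Ioc a b, ∫⁻ s in Kᶜ, ENNReal.ofReal (ε / ((t - s) ^ 2 + ε ^ 2)) ∂ν := by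
        rw [lintegral_add_left]
        exact (measurable_one.indicator hTm).add_const _
    _ ≤ (ENNReal.ofReal η + ENNReal.ofReal η) + ENNReal.ofReal Real.pi * ENNReal.ofReal η := by
        gcongr
        · rw [lintegral_add_left (measurable_one.indicator hTm), lintegral_indicator_one hTm,
            setLIntegral_const]
          gcongr
          exact (Measure.restrict_apply_le _ _).trans hδ
        · calc _ ≤ ∫⁻ t, ∫⁻ s in Kᶜ, ENNReal.ofReal (ε / ((t - s) ^ 2 + ε ^ 2)) ∂ν :=
                setLIntegral_le_lintegral _ _
            _ = ∫⁻ s in Kᶜ, (∫⁻ t, ENNReal.ofReal (ε / ((t - s) ^ 2 + ε ^ 2))) ∂ν :=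
                lintegral_lintegral_swap hmeas.aemeasurable
            _ = ENNReal.ofReal Real.pi * ν Kᶜ := by
                simp_rw [pois_lint hε0]
                rw [setLIntegral_const]
            _ ≤ _ := by gcongr

lemma real_conv (ν : Measure ℝ) [IsProbabilityMeasure ν]
    (hnull : ∃ N : Set ℝ, MeasurableSet N ∧ volume N = 0 ∧ ν N = 1) (a b : ℝ) (hab : a ≤ b) :
    Tendsto (fun ε : ℝ => ∫ t in a..b, min 1 (-(cauchyG ν (t + ε * I)).im)) (𝓝[>] 0) (𝓝 0) := by
  have h := (ENNReal.continuousAt_toReal ENNReal.zero_ne_top).tendsto.comp (lint_conv ν hnull a b)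
  rw [ENNReal.toReal_zero] at h
  refine h.congr' ?_
  filter_upwards [self_mem_nhdsWithin] with ε hε
  have hε0 : 0 < ε := hε
  have him : ∀ t : ℝ, 0 < ((t:ℂ) + ε * I).im := fun t => by simpa using hε0
  have hnn : ∀ t : ℝ, 0 ≤ min 1 (-(cauchyG ν (t + ε * I)).im) := fun t =>
    le_min zero_le_one (by linarith [im_G_neg ν (him t)])
  have hcont : Continuous fun t : ℝ => min 1 (-(cauchyG ν (t + ε * I)).im) := by
    have : Continuous fun t : ℝ => cauchyG ν (t + ε * I) := by
      rw [← continuousOn_univ]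
      exact (diff_G ν).continuousOn.comp (by fun_prop) fun t _ => him t
    fun_prop
  rw [intervalIntegral.integral_of_le hab, integral_eq_lintegral_of_nonneg_ae
    (ae_of_all _ hnn) hcont.aestronglyMeasurable]
  simp only [Function.comp_apply]
  congr 1
  refine lintegral_congr fun t => ?_
  rw [ENNReal.ofReal_min, ENNReal.ofReal_one, neg_im_G ν (him t),
    ofReal_integral_eq_lintegral_ofReal (integrable_pois ν (him t))
      (ae_of_all _ fun s => by have := him t; positivity)]
  simp

/-- The Möbius transform. -/
def mob (w g : ℂ) : ℂ := (g - w) / (g - (starRingEnd ℂ) w)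

lemma mob_den {w g : ℂ} (hw : w.im < 0) (hg : g.im < 0) :
    -w.im ≤ ‖g - (starRingEnd ℂ) w‖ := by
  have := Complex.abs_im_le_norm (g - (starRingEnd ℂ) w)
  simp only [sub_im, conj_im, sub_neg_eq_add] at this
  rw [abs_of_neg (by linarith)] at this
  linarith

lemma mob_sq {w g : ℂ} (hw : w.im < 0) (hg : g.im < 0) :
    1 - ‖mob w g‖ ^ 2 = 4 * g.im * w.im / ‖g - (starRingEnd ℂ) w‖ ^ 2 := by
  have hD : 0 < ‖g - (starRingEnd ℂ) w‖ := by linarith [mob_den hw hg]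
  rw [mob, norm_div, div_pow, eq_div_iff (by positivity), sub_mul, one_mul,
    div_mul_cancel₀ _ (by positivity), Complex.sq_norm, Complex.sq_norm, Complex.normSq_apply,
    Complex.normSq_apply]
  simp
  ring

lemma mob_one {w g : ℂ} (hw : w.im < 0) (hg : g.im < 0) :
    ‖1 - mob w g‖ = 2 * (-w.im) / ‖g - (starRingEnd ℂ) w‖ := by
  have hD : 0 < ‖g - (starRingEnd ℂ) w‖ := by linarith [mob_den hw hg]
  have hne : g - (starRingEnd ℂ) w ≠ 0 := norm_pos_iff.1 hD
  have : 1 - mob w g = (w - (starRingEnd ℂ) w) / (g - (starRingEnd ℂ) w) := by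
    rw [mob, eq_div_iff hne, sub_mul, div_mul_cancel₀ _ hne]; ring
  rw [this, norm_div, Complex.sub_conj]
  congr 1
  rw [norm_mul, norm_I, mul_one, norm_real, Real.norm_eq_abs, abs_of_neg (by linarith)]
  ring

lemma refl_norm {B : ℂ} (hB : B ≠ 0) (h1 : ‖B‖ ≤ 1) :
    ‖B - ((starRingEnd ℂ) B)⁻¹‖ = (1 - ‖B‖ ^ 2) / ‖B‖ := by
  have hc : (starRingEnd ℂ) B ≠ 0 := by simpa using hB
  have : B - ((starRingEnd ℂ) B)⁻¹ = ((‖B‖ ^ 2 - 1 : ℝ) : ℂ) / (starRingEnd ℂ) B := by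
    rw [eq_div_iff hc, sub_mul, inv_mul_cancel₀ hc, Complex.mul_conj, Complex.normSq_eq_norm_sq]
    push_cast
    ring
  rw [this, norm_div, norm_real, Complex.norm_conj, Real.norm_eq_abs, abs_of_nonpos]
  · ring
  · nlinarith [norm_nonneg B]

lemma lip_of_diff (Φ : ℂ → ℂ) (x : ℂ) (r : ℝ) (hr : 0 < r)
    (h : DifferentiableOn ℂ Φ (Metric.ball x r)) :
    ∃ C > 0, ∀ z ∈ Metric.ball x (r / 2), ∀ w ∈ Metric.ball x (r / 2),
      ‖Φ z - Φ w‖ ≤ C * ‖z - w‖ := by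
  have hsub : Metric.closedBall x (r / 2) ⊆ Metric.ball x r :=
    Metric.closedBall_subset_ball (by linarith)
  have hc : ContinuousOn (deriv Φ) (Metric.closedBall x (r / 2)) :=
    (h.deriv Metric.isOpen_ball).continuousOn.mono hsub
  obtain ⟨C, hC⟩ := (isCompact_closedBall x (r / 2)).exists_bound_of_continuousOn hc
  refine ⟨max C 1, by positivity, fun z hz w hw => ?_⟩
  refine (convex_ball x (r / 2)).norm_image_sub_le_of_norm_deriv_le (𝕜 := ℂ) ?_ ?_ hw hz
  · intro y hy
    exact h.differentiableAt (Metric.isOpen_ball.mem_nhds (hsub (Metric.ball_subset_closedBall hy)))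
  · intro y hy
    exact (hC y (Metric.ball_subset_closedBall hy)).trans (le_max_left _ _)

lemma main_aux (ν : Measure ℝ) [IsProbabilityMeasure ν]
    (hsupp : ∀ x : ℝ, ∀ ε > 0, 0 < ν (Set.Ioo (x - ε) (x + ε)))
    (hnull : ∃ N : Set ℝ, MeasurableSet N ∧ volume N = 0 ∧ ν N = 1)
    (x : ℝ) (w : ℂ) (hw : w.im < 0) (ρ r : ℝ) (hρ : 0 < ρ) (hr : 0 < r) :
    ∃ z ∈ UHP, ‖z - x‖ < r ∧ ‖cauchyG ν z - w‖ < ρ := by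
  by_contra hcon
  push Not at hcon
  have hβ : 0 < -w.im := by linarith
  set β := -w.im with hβdef
  have hG : ∀ z ∈ UHP, (cauchyG ν z).im < 0 := fun z hz => im_G_neg ν hz
  set B : ℂ → ℂ := fun z => mob w (cauchyG ν z) with hB
  have hBd : DifferentiableOn ℂ B UHP := by
    intro z hz
    have h1 := diff_G ν z hz
    refine (h1.sub_const w).div (h1.sub_const _) ?_
    have := mob_den hw (hG z hz)
    exact norm_pos_iff.1 (by linarith)
  have hB1 : ∀ z ∈ UHP, ‖B z‖ ≤ 1 := by
    intro z hz
    have h1 := mob_sq hw (hG z hz)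
    have h2 : 0 ≤ 4 * (cauchyG ν z).im * w.im / ‖cauchyG ν z - (starRingEnd ℂ) w‖ ^ 2 := by
      apply div_nonneg _ (by positivity)
      nlinarith [mul_pos_of_neg_of_neg (hG z hz) hw]
    have h3 : ‖B z‖ ^ 2 ≤ 1 := by rw [← h1] at h2; simpa [hB] using h2
    nlinarith [norm_nonneg (B z)]
  set δ := ρ / (ρ + 2 * β) with hδ
  have hδ0 : 0 < δ := by positivity
  have hBδ : ∀ z ∈ Metric.ball (x:ℂ) r ∩ UHP, δ ≤ ‖B z‖ := by
    intro z hz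
    have h1 := hcon z hz.2 (by rw [← dist_eq_norm]; exact hz.1)
    have h2 := mob_den hw (hG z hz.2)
    have h3 : ‖cauchyG ν z - (starRingEnd ℂ) w‖ ≤ ‖cauchyG ν z - w‖ + 2 * β := by
      have : cauchyG ν z - (starRingEnd ℂ) w = (cauchyG ν z - w) + (w - (starRingEnd ℂ) w) := by ring
      rw [this]
      refine (norm_add_le _ _).trans ?_
      gcongr
      rw [Complex.sub_conj, norm_mul, norm_I, mul_one, norm_real, Real.norm_eq_abs,
        abs_of_neg (by linarith)]
      linarith
    simp only [hB, mob, norm_div]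
    rw [hδ, div_le_div_iff₀ (by positivity) (by linarith)]
    nlinarith
  have hBne : ∀ z ∈ Metric.ball (x:ℂ) r ∩ UHP, B z ≠ 0 := fun z hz =>
    norm_pos_iff.1 (hδ0.trans_le (hBδ z hz))
  have hconj : ∀ z ∈ Metric.ball (x:ℂ) r ∩ LHP,
      (starRingEnd ℂ) z ∈ Metric.ball (x:ℂ) r ∩ UHP := by
    rintro z ⟨h1, h2⟩
    refine ⟨?_, by simpa [UHP, LHP] using h2⟩
    rw [Metric.mem_ball, dist_eq_norm] at h1 ⊢
    rw [← Complex.norm_conj]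
    simpa using h1
  have hUo : IsOpen UHP := isOpen_lt continuous_const continuous_im
  have hglue : ∃ Φ : ℂ → ℂ, DifferentiableOn ℂ Φ (Metric.ball (x:ℂ) r) ∧
      (∀ z ∈ Metric.ball (x:ℂ) r ∩ UHP, Φ z = B z) ∧
      (∀ z ∈ Metric.ball (x:ℂ) r ∩ LHP, Φ z = ((starRingEnd ℂ) (B ((starRingEnd ℂ) z)))⁻¹) := by
    refine glue B (fun z => ((starRingEnd ℂ) (B ((starRingEnd ℂ) z)))⁻¹)
      x r hr (1 + δ⁻¹) (hBd.mono inter_subset_right) ?_ ?_ ?_ ?_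
    · intro z hz
      have hz' := hconj z hz
      have h1 : DifferentiableAt ℂ B ((starRingEnd ℂ) z) :=
        hBd.differentiableAt (hUo.mem_nhds hz'.2)
      have h2 := h1.conj_conj
      simp only [Complex.conj_conj] at h2
      refine (h2.inv ?_).differentiableWithinAt
      simpa using hBne _ hz'
    · intro z hz
      have := hB1 z hz.2
      have : 0 < δ⁻¹ := by positivity
      linarith
    · intro z hz
      rw [norm_inv, Complex.norm_conj]
      have := inv_anti₀ hδ0 (hBδ _ (hconj z hz))
      linarith
    · intro a b hab ha hb
      have hlim := (real_conv ν hnull a b hab).const_mul ((1 + 4 / β) / δ)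
      rw [mul_zero] at hlim
      refine squeeze_zero' ?_ ?_ hlim
      · exact Eventually.of_forall fun ε => intervalIntegral.integral_nonneg hab
          fun t _ => norm_nonneg _
      · obtain ⟨m, hm0, hm1⟩ : ∃ m, 0 < m ∧ ∀ t ∈ Icc a b, |t - x| + m < r := by
          refine ⟨min (a - (x - r)) (x + r - b) / 2, by
            have := sub_pos.2 ha
            have := sub_pos.2 hb
            positivity, ?_⟩
          intro t ht
          have h1 := min_le_left (a - (x - r)) (x + r - b)
          have h2 := min_le_right (a - (x - r)) (x + r - b)
          have h3 : 0 < min (a - (x - r)) (x + r - b) := lt_min (sub_pos.2 ha) (sub_pos.2 hb)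
          rcases abs_cases (t - x) with ⟨h, _⟩ | ⟨h, _⟩ <;> rw [h] <;> linarith [ht.1, ht.2]
        filter_upwards [Ioo_mem_nhdsGT hm0] with ε hε
        have memp : ∀ t ∈ Icc a b, (t + ε * I : ℂ) ∈ Metric.ball (x:ℂ) r ∩ UHP := by
          intro t ht
          refine ⟨?_, by simpa [UHP] using hε.1⟩
          rw [Metric.mem_ball, dist_eq_norm]
          have : (t + ε * I - x : ℂ) = ((t - x : ℝ) : ℂ) + ε * I := by push_cast; ring
          rw [this]
          refine (norm_add_le _ _).trans_lt ?_
          rw [norm_mul, norm_I, mul_one, norm_real, norm_real, Real.norm_eq_abs, Real.norm_eq_abs,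
            abs_of_pos hε.1]
          linarith [hm1 t ht, hε.2]
        have hcj : ∀ t : ℝ, (starRingEnd ℂ) ((t:ℂ) - ε * I) = t + ε * I := by
          intro t; simp
        simp only [hcj]
        have hcB : ContinuousOn (fun t : ℝ => B (t + ε * I)) (Icc a b) :=
          hBd.continuousOn.comp (by fun_prop) fun t ht => (memp t ht).2
        have hcG : ContinuousOn (fun t : ℝ => cauchyG ν (t + ε * I)) (Icc a b) :=
          (diff_G ν).continuousOn.comp (by fun_prop) fun t ht => (memp t ht).2
        rw [← intervalIntegral.integral_const_mul]
        refine intervalIntegral.integral_mono_on hab ?_ ?_ ?_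
        · apply ContinuousOn.intervalIntegrable
          rw [uIcc_of_le hab]
          refine (hcB.sub (ContinuousOn.inv₀ (Complex.continuous_conj.comp_continuousOn hcB) ?_)).norm
          intro t ht
          simpa using hBne _ (memp t ht)
        · apply ContinuousOn.intervalIntegrable
          rw [uIcc_of_le hab]
          refine continuousOn_const.mul (continuousOn_const.inf ?_)
          exact (Complex.continuous_im.comp_continuousOn hcG).neg
        · intro t ht
          have hz := memp t ht
          set z : ℂ := t + ε * I
          have e1 := hB1 z hz.2
          have e2 := hBδ z hz
          have e3 := mob_den hw (hG z hz.2)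
          have e4 : 1 - ‖B z‖ ^ 2 = _ := mob_sq hw (hG z hz.2)
          have e5 := hG z hz.2
          rw [refl_norm (hBne z hz) e1]
          have e6 : 1 - ‖B z‖ ^ 2 ≤ (4 / β) * (-(cauchyG ν z).im) := by
            rw [e4, div_mul_eq_mul_div, div_le_div_iff₀ (pow_pos (hβ.trans_le e3) 2) hβ]
            have : β ^ 2 ≤ ‖cauchyG ν z - (starRingEnd ℂ) w‖ ^ 2 := pow_le_pow_left₀ hβ.le e3 2
            have hwβ : w.im = -β := by rw [hβdef]; ring
            rw [hwβ]
            nlinarith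
          have e7 : 1 - ‖B z‖ ^ 2 ≤ (1 + 4 / β) * min 1 (-(cauchyG ν z).im) := by
            have h4 : 0 < 4 / β := by positivity
            rcases le_total 1 (-(cauchyG ν z).im) with h | h
            · rw [min_eq_left h]
              nlinarith [sq_nonneg ‖B z‖]
            · rw [min_eq_right h]
              nlinarith
          have e8 : 0 ≤ 1 - ‖B z‖ ^ 2 := by nlinarith [norm_nonneg (B z)]
          calc (1 - ‖B z‖ ^ 2) / ‖B z‖ ≤ (1 - ‖B z‖ ^ 2) / δ := by gcongr
            _ ≤ ((1 + 4 / β) * min 1 (-(cauchyG ν z).im)) / δ := by gcongr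
            _ = _ := by ring
  obtain ⟨Φ, hΦd, hΦp, hΦm⟩ := hglue
  obtain ⟨C, hC0, hC⟩ := lip_of_diff Φ x r hr hΦd
  have hhalf : Metric.ball (x:ℂ) (r / 2) ⊆ Metric.ball (x:ℂ) r :=
    Metric.ball_subset_ball (by linarith)
  have hLip : ∀ z ∈ Metric.ball (x:ℂ) (r / 2) ∩ UHP, ∀ z' ∈ Metric.ball (x:ℂ) (r / 2) ∩ UHP,
      ‖B z - B z'‖ ≤ C * ‖z - z'‖ := by
    intro z hz z' hz'
    rw [← hΦp z ⟨hhalf hz.1, hz.2⟩, ← hΦp z' ⟨hhalf hz'.1, hz'.2⟩]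
    exact hC z hz.1 z' hz'.1
  have hlin : ∀ z ∈ Metric.ball (x:ℂ) (r / 2) ∩ UHP, 1 - ‖B z‖ ^ 2 ≤ C * (2 * z.im) := by
    intro z hz
    have hzi : 0 < z.im := hz.2
    have hz2 : z ∈ Metric.ball (x:ℂ) r ∩ UHP := ⟨hhalf hz.1, hz.2⟩
    have hcz : (starRingEnd ℂ) z ∈ Metric.ball (x:ℂ) (r / 2) ∩ LHP := by
      refine ⟨?_, by simpa [LHP] using hzi⟩
      have h1 := hz.1
      rw [Metric.mem_ball, dist_eq_norm] at h1 ⊢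
      rw [← Complex.norm_conj]
      simpa using h1
    have h := hC z hz.1 _ hcz.1
    rw [hΦp z hz2, hΦm _ ⟨hhalf hcz.1, hcz.2⟩] at h
    simp only [Complex.conj_conj] at h
    rw [refl_norm (hBne z hz2) (hB1 z hz.2), Complex.sub_conj, norm_mul, norm_I, mul_one, norm_real,
      Real.norm_eq_abs, abs_of_pos (by linarith)] at h
    have e1 := hB1 z hz.2
    have e0 : 0 < ‖B z‖ := norm_pos_iff.2 (hBne z hz2)
    rw [div_le_iff₀ e0] at h
    have : 0 ≤ C * (2 * z.im) := by positivity
    nlinarith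
  -- choose a point off the null set
  obtain ⟨N, hNm, hN0, hN1⟩ := hnull
  obtain ⟨t₀, ht₀, ht₀N⟩ : ∃ t₀ ∈ Ioo (x - r / 4) (x + r / 4), t₀ ∉ N := by
    by_contra hcon2
    push Not at hcon2
    have h1 : volume (Ioo (x - r / 4) (x + r / 4)) = 0 := measure_mono_null hcon2 hN0
    rw [Real.volume_Ioo, ENNReal.ofReal_eq_zero] at h1
    linarith
  have hatom : ν {t₀} = 0 := by
    have hNc : ν Nᶜ = 0 := by rw [prob_compl_eq_zero_iff hNm]; exact hN1
    exact measure_mono_null (by simpa using ht₀N) hNc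
  have hml : Tendsto (fun y : ℝ => ‖(y : ℂ) * (cauchyG ν (t₀ + y * I) - (starRingEnd ℂ) w)‖)
      (𝓝[>] 0) (𝓝 0) := by
    have h1 := mass_lim ν t₀ hatom
    have h2 : Tendsto (fun y : ℝ => (y : ℂ) * (starRingEnd ℂ) w) (𝓝[>] 0) (𝓝 0) := by
      have : Continuous (fun y : ℝ => (y : ℂ) * (starRingEnd ℂ) w) := by fun_prop
      have := this.tendsto 0
      simp only [ofReal_zero, zero_mul] at this
      exact this.mono_left nhdsWithin_le_nhds
    have h3 := (h1.sub h2).norm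
    simp only [sub_zero, norm_zero] at h3
    refine h3.congr fun y => ?_
    rw [mul_sub]
  have hpos : 0 < 2 * β / (4 * C) := by positivity
  obtain ⟨y, hy1, hy2⟩ := ((hml.eventually_lt_const hpos).and
    (Ioo_mem_nhdsGT (show (0:ℝ) < r / 8 by positivity))).exists
  have hy0 : 0 < y := hy2.1
  have hball : ∀ z ∈ Metric.ball (t₀:ℂ) (2 * y), z ∈ Metric.ball (x:ℂ) (r / 2) := by
    intro z hz
    rw [Metric.mem_ball] at hz ⊢
    have h1 : dist (t₀:ℂ) x < r / 4 := by
      rw [dist_eq_norm, ← ofReal_sub, norm_real, Real.norm_eq_abs, abs_lt]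
      constructor <;> linarith [ht₀.1, ht₀.2]
    linarith [dist_triangle z t₀ x, hy2.2]
  set z₀ : ℂ := t₀ + y * I with hz₀
  have hd0 : ‖z₀ - t₀‖ = y := by
    rw [hz₀]; simp [abs_of_pos hy0]
  have hz₀U : z₀ ∈ UHP := by simpa [UHP, hz₀] using hy0
  have hz₀b : z₀ ∈ Metric.ball (x:ℂ) (r / 2) := by
    apply hball
    rw [Metric.mem_ball, dist_eq_norm, hd0]
    linarith
  have hbig : 4 * C * y ≤ ‖1 - B z₀‖ := by
    have e : ‖1 - B z₀‖ = _ := mob_one hw (hG z₀ hz₀U)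
    have e3 := mob_den hw (hG z₀ hz₀U)
    rw [e, le_div_iff₀ (by linarith)]
    rw [norm_mul, norm_real, Real.norm_eq_abs, abs_of_pos hy0, lt_div_iff₀ (by positivity)] at hy1
    nlinarith
  refine no_linear ν hsupp t₀ y (C * 2 * β / (2 * C * y) ^ 2) hy0 ?_
  intro z hz
  have hzi : 0 < z.im := hz.2
  have hzb : z ∈ Metric.ball (x:ℂ) (r / 2) :=
    hball z (Metric.ball_subset_ball (by linarith) hz.1)
  have hzd : ‖z - z₀‖ ≤ 2 * y := by
    have : z - z₀ = (z - t₀) - (z₀ - t₀) := by ring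
    rw [this]
    refine (norm_sub_le _ _).trans ?_
    have h1 := hz.1
    rw [Metric.mem_ball, dist_eq_norm] at h1
    linarith
  have h1B : 2 * C * y ≤ ‖1 - B z‖ := by
    have h1 := hLip z ⟨hzb, hz.2⟩ z₀ ⟨hz₀b, hz₀U⟩
    have h2 : ‖1 - B z₀‖ ≤ ‖1 - B z‖ + ‖B z - B z₀‖ := by
      have : 1 - B z₀ = (1 - B z) + (B z - B z₀) := by ring
      rw [this]
      exact norm_add_le _ _
    nlinarith
  have e1 := hlin z ⟨hzb, hz.2⟩
  have e4 : 1 - ‖B z‖ ^ 2 = _ := mob_sq hw (hG z hz.2)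
  have e5 : ‖1 - B z‖ = _ := mob_one hw (hG z hz.2)
  have e3 := mob_den hw (hG z hz.2)
  set D := ‖cauchyG ν z - (starRingEnd ℂ) w‖ with hD
  have hD0 : 0 < D := by linarith
  have hid : -(cauchyG ν z).im = β * (1 - ‖B z‖ ^ 2) / ‖1 - B z‖ ^ 2 := by
    rw [e4, e5]
    have hwβ : w.im = -β := by rw [hβdef]; ring
    rw [hwβ]
    field_simp
    ring
  rw [hid]
  calc β * (1 - ‖B z‖ ^ 2) / ‖1 - B z‖ ^ 2
      ≤ β * (C * (2 * z.im)) / (2 * C * y) ^ 2 := by gcongr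
    _ = _ := by ring

theorem stmt1 (ν : Measure ℝ) [IsProbabilityMeasure ν]
    (hsupp : ∀ x : ℝ, ∀ ε > 0, 0 < ν (Set.Ioo (x - ε) (x + ε)))
    (hnull : ∃ N : Set ℝ, MeasurableSet N ∧ volume N = 0 ∧ ν N = 1) :
    ∀ x : ℝ, clusterSetUHP (cauchyG ν) x
      = closure ((fun w : ℂ => (w : OnePoint ℂ)) '' LHP) := by
  intro x
  apply Subset.antisymm
  · rintro l ⟨u, hu, -, hl⟩
    refine mem_closure_of_tendsto hl (Eventually.of_forall fun n => ?_)
    exact ⟨_, im_G_neg ν (hu n), rfl⟩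
  · intro l hl
    -- approximating sequence in the lower half-plane
    have haux : ∀ v : ℕ → ℂ, (∀ n, (v n).im < 0) → ∃ u : ℕ → ℂ, (∀ n, u n ∈ UHP) ∧
        Tendsto u atTop (nhds (x : ℂ)) ∧
        Tendsto (fun n => cauchyG ν (u n) - v n) atTop (𝓝 0) := by
      intro v hv
      have h1 : ∀ n : ℕ, ∃ z ∈ UHP, ‖z - x‖ < 1 / ((n:ℝ) + 1) ∧
          ‖cauchyG ν z - v n‖ < 1 / ((n:ℝ) + 1) := fun n =>
        main_aux ν hsupp hnull x (v n) (hv n) _ _ (by positivity) (by positivity)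
      choose u hu1 hu2 hu3 using h1
      refine ⟨u, hu1, ?_, ?_⟩
      · rw [tendsto_iff_norm_sub_tendsto_zero]
        exact squeeze_zero (fun n => norm_nonneg _) (fun n => (hu2 n).le)
          tendsto_one_div_add_atTop_nhds_zero_nat
      · exact squeeze_zero_norm (fun n => (hu3 n).le) tendsto_one_div_add_atTop_nhds_zero_nat
    induction l using OnePoint.rec with
    | infty =>
      obtain ⟨u, hu, hux, hlim⟩ := haux (fun n => -((n:ℂ) + 1) * I) (by
        intro n
        have : (0:ℝ) ≤ n := n.cast_nonneg
        simp
        linarith)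
      refine ⟨u, hu, hux, ?_⟩
      refine OnePoint.tendsto_coe_infty.comp ?_
      rw [Filter.coclosedCompact_eq_cocompact]
      rw [← Metric.cobounded_eq_cocompact, ← tendsto_norm_atTop_iff_cobounded]
      refine tendsto_atTop_mono' _ ?_ (tendsto_natCast_atTop_atTop (R := ℝ))
      have h0 := hlim.norm
      rw [norm_zero] at h0
      filter_upwards [h0.eventually_lt_const one_pos] with n hn
      have e1 : ‖-((n:ℂ) + 1) * I‖ = (n:ℝ) + 1 := by
        rw [norm_mul, norm_I, mul_one, norm_neg]
        have : ((n:ℂ) + 1) = ((n + 1 : ℕ) : ℂ) := by push_cast; ring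
        rw [this, Complex.norm_natCast]
        push_cast
        ring
      have e2 := norm_sub_norm_le (-((n:ℂ) + 1) * I) (cauchyG ν (u n))
      rw [norm_sub_rev, e1] at e2
      linarith
    | coe w =>
      have hw : w.im ≤ 0 := by
        by_contra hcon
        push Not at hcon
        have hUo : IsOpen UHP := isOpen_lt continuous_const continuous_im
        have h1 := mem_closure_iff.1 hl _ (OnePoint.isOpen_image_coe.2 hUo) ⟨w, hcon, rfl⟩
        obtain ⟨_, ⟨a, ha, rfl⟩, ⟨b, hb, hab⟩⟩ := h1
        have : b = a := OnePoint.coe_injective hab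
        rw [this] at hb
        exact lt_asymm (show 0 < a.im from ha) hb
      obtain ⟨u, hu, hux, hlim⟩ := haux (fun n => w - ((1 / ((n:ℝ) + 1) : ℝ) : ℂ) * I) (by
        intro n
        have : (0:ℝ) < 1 / ((n:ℝ) + 1) := by positivity
        rw [sub_im, mul_I_im, ofReal_re]
        linarith)
      refine ⟨u, hu, hux, ?_⟩
      refine (OnePoint.continuous_coe.tendsto w).comp ?_
      have h2 : Tendsto (fun n : ℕ => w - ((1 / ((n:ℝ) + 1) : ℝ) : ℂ) * I) atTop (𝓝 w) := by
        have h3 := (Complex.continuous_ofReal.tendsto 0).comp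
          (tendsto_one_div_add_atTop_nhds_zero_nat (𝕜 := ℝ))
        have h4 := (h3.mul_const I).const_sub w
        simpa using h4
      have h5 := hlim.add h2
      simpa using h5

end
end

section
/- Let λ ∈ (0,1); let μ be a symmetric Borel probability measure on ℝ that is ⊞_λ-infinitely divisible with rectangular R-transform C, and let ν, ρ be symmetric Borel probability measures on ℝ such that ρ is the rectangular free convolution μ ⊞_λ ν. Then the subordination function ω₂(z) = H_ρ(z)/T(M_ρ(z) − C(H_ρ(z))) extends to an analytic map from ℂ∖[0,∞) into ℂ∖[0,∞) satisfying: H_ν(ω₂(z)) = H_ρ(z) and ω₂(z̄) = conj(ω₂(z)) for all z ∈ ℂ∖[0,∞); lim_{x↑0} ω₂(x) = 0; ω₂ is injective, being a right inverse of the meromorphic function k(w) = H_ν(w)/T(C(H_ν(w)) + M_ν(w)); and arg z ≤ arg ω₂(z) < π for all z ∈ ℂ⁺. -/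
open MeasureTheory Complex Set Filter Topology

noncomputable section

/-- The nonnegative real axis, viewed as a subset of `ℂ`. -/
def posAxis : Set ℂ := {z : ℂ | z.im = 0 ∧ 0 ≤ z.re}

/-- `M_μ(z) = ∫ z t² / (1 - z t²) dμ(t)`. -/
def Mt (μ : Measure ℝ) (z : ℂ) : ℂ := ∫ t : ℝ, z * (t : ℂ) ^ 2 / (1 - z * (t : ℂ) ^ 2) ∂μ

/-- `H_μ(z) = z (1 + M_μ(z)) (1 + λ M_μ(z))`. -/
def Ht (l : ℝ) (μ : Measure ℝ) (z : ℂ) : ℂ :=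
  z * (1 + Mt μ z) * (1 + (l : ℂ) * Mt μ z)

/-- `T(w) = (λ w + 1)(w + 1)`. -/
def Tfun (l : ℝ) (w : ℂ) : ℂ := ((l : ℂ) * w + 1) * (w + 1)

/-- The rectangular `R`-transform with Lévy measure `G`:
`C(z) = z ∫ (1+t²)/(1-z t²) dG(t)`. -/
def rectC (G : Measure ℝ) (z : ℂ) : ℂ :=
  z * ∫ t : ℝ, (1 + (t : ℂ) ^ 2) / (1 - z * (t : ℂ) ^ 2) ∂G

/-- `μ` is `⊞_λ`-infinitely divisible with rectangular `R`-transform `C = rectC G`: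
`H_μ(x) = x T(C(H_μ(x)))` for `x < 0` close to `0`. -/
def IsRectInfDiv (l : ℝ) (μ G : Measure ℝ) : Prop :=
  ∃ ε > (0 : ℝ), ∀ x ∈ Set.Ioo (-ε) (0 : ℝ),
    Ht l μ (x : ℂ) = (x : ℂ) * Tfun l (rectC G (Ht l μ (x : ℂ)))

/-- `ρ` is the rectangular free convolution `μ ⊞_λ ν`, where `μ` has rectangular
`R`-transform `rectC G`. -/
def IsRectConv (l : ℝ) (G ν ρ : Measure ℝ) : Prop :=
  ∃ ε > (0 : ℝ), ∀ x ∈ Set.Ioo (-ε) (0 : ℝ),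
    Tfun l (Mt ρ (x : ℂ) - rectC G (Ht l ρ (x : ℂ))) ≠ 0 ∧
    Ht l ρ (x : ℂ) =
      Ht l ν (Ht l ρ (x : ℂ) / Tfun l (Mt ρ (x : ℂ) - rectC G (Ht l ρ (x : ℂ))))

/-- The common kernel integral. -/
def kerI (g : ℝ → ℂ) (μ : Measure ℝ) (z : ℂ) : ℂ := ∫ t : ℝ, g t / (1 - z * (t : ℂ) ^ 2) ∂μ

lemma ker_bound {z : ℂ} (hz : z ∉ posAxis) :
    ∃ c > (0 : ℝ), ∀ w ∈ Metric.ball z c, ∀ t : ℝ,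
      c * (1 + t ^ 2) ≤ ‖1 - w * (t : ℂ) ^ 2‖ := by
  have hcont : ContinuousOn (fun s : ℝ => ‖(s : ℂ) - z * (1 - (s : ℂ))‖) (Set.Icc 0 1) := by
    fun_prop
  obtain ⟨s0, hs0, hmin⟩ := isCompact_Icc.exists_isMinOn (⟨0, by simp⟩ : (Set.Icc (0 : ℝ) 1).Nonempty) hcont
  have hpos : 0 < ‖(s0 : ℂ) - z * (1 - (s0 : ℂ))‖ := by
    rw [norm_pos_iff]
    intro h
    apply hz
    have h1 := congrArg Complex.re h
    have h2 := congrArg Complex.im h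
    simp at h1 h2
    have hs1 : s0 ≠ 1 := by
      rintro rfl
      simp at h1
    have h3 : 0 < 1 - s0 := by
      have := lt_of_le_of_ne hs0.2 hs1
      linarith
    have h4 : z.im = 0 := by
      rcases h2 with h2 | h2
      · exact h2
      · exact absurd h2 h3.ne'
    refine ⟨h4, ?_⟩
    by_contra hneg
    push Not at hneg
    nlinarith [hs0.1]
  set c0 := ‖(s0 : ℂ) - z * (1 - (s0 : ℂ))‖ with hc0
  refine ⟨c0 / 2, by positivity, ?_⟩
  intro w hw t
  have ht : (0 : ℝ) < 1 + t ^ 2 := by positivity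
  have htc : (1 + (t : ℂ) ^ 2) ≠ 0 := by
    have : ((1 + t ^ 2 : ℝ) : ℂ) ≠ 0 := by exact_mod_cast ht.ne'
    simpa using this
  set s : ℝ := 1 / (1 + t ^ 2) with hs
  have hsI : s ∈ Set.Icc (0 : ℝ) 1 := by
    refine ⟨by positivity, ?_⟩
    rw [hs, div_le_one ht]
    nlinarith [sq_nonneg t]
  have h1 : c0 ≤ ‖(s : ℂ) - z * (1 - (s : ℂ))‖ := hmin hsI
  have h2 : ‖(w - z) * (1 - (s : ℂ))‖ ≤ c0 / 2 := by
    rw [norm_mul]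
    have h3 : ‖w - z‖ < c0 / 2 := by simpa [dist_eq_norm] using hw
    have h4 : ‖(1 - (s : ℂ))‖ ≤ 1 := by
      have : (1 - (s : ℂ)) = ((1 - s : ℝ) : ℂ) := by push_cast; ring
      rw [this, Complex.norm_real, Real.norm_eq_abs, abs_le]
      constructor <;> linarith [hsI.1, hsI.2]
    nlinarith [norm_nonneg (w - z), norm_nonneg (1 - (s : ℂ))]
  have h3 : c0 / 2 ≤ ‖(s : ℂ) - w * (1 - (s : ℂ))‖ := by
    have h5 : (s : ℂ) - z * (1 - (s : ℂ)) = ((s : ℂ) - w * (1 - (s : ℂ))) + (w - z) * (1 - (s : ℂ)) := by ring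
    have h6 := norm_add_le ((s : ℂ) - w * (1 - (s : ℂ))) ((w - z) * (1 - (s : ℂ)))
    rw [← h5] at h6
    linarith
  have h7 : 1 - w * (t : ℂ) ^ 2 = ((1 + t ^ 2 : ℝ) : ℂ) * ((s : ℂ) - w * (1 - (s : ℂ))) := by
    rw [hs]; push_cast; field_simp; ring
  rw [h7, norm_mul, Complex.norm_real, Real.norm_eq_abs, abs_of_pos ht]
  nlinarith

lemma ker_ne {z : ℂ} (hz : z ∉ posAxis) (t : ℝ) : 1 - z * (t : ℂ) ^ 2 ≠ 0 := by
  obtain ⟨c, hc, h⟩ := ker_bound hz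
  have := h z (Metric.mem_ball_self hc) t
  rw [← norm_pos_iff]
  have : 0 < c * (1 + t ^ 2) := by positivity
  linarith

lemma ker_meas (g : ℝ → ℂ) (hg : Measurable g) (z : ℂ) :
    Measurable (fun t : ℝ => g t / (1 - z * (t : ℂ) ^ 2)) := by
  fun_prop

lemma ker_norm_le {g : ℝ → ℂ} (hb : ∀ t, ‖g t‖ ≤ 1 + t ^ 2) {c : ℝ} (hc : 0 < c) {w : ℂ}
    {t : ℝ} (h : c * (1 + t ^ 2) ≤ ‖1 - w * (t : ℂ) ^ 2‖) :
    ‖g t / (1 - w * (t : ℂ) ^ 2)‖ ≤ 1 / c := by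
  have ht : (0 : ℝ) < 1 + t ^ 2 := by positivity
  have h1 : 0 < c * (1 + t ^ 2) := by positivity
  rw [norm_div, div_le_div_iff₀ (by linarith) hc]
  nlinarith [hb t]

lemma ker_integrable (g : ℝ → ℂ) (hg : Measurable g) (hb : ∀ t, ‖g t‖ ≤ 1 + t ^ 2)
    (μ : Measure ℝ) [IsFiniteMeasure μ] {z : ℂ} (hz : z ∉ posAxis) :
    Integrable (fun t : ℝ => g t / (1 - z * (t : ℂ) ^ 2)) μ := by
  obtain ⟨c, hc, h⟩ := ker_bound hz
  refine Integrable.of_bound (ker_meas g hg z).aestronglyMeasurable (1 / c) ?_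
  exact Filter.Eventually.of_forall fun t => ker_norm_le hb hc (h z (Metric.mem_ball_self hc) t)

lemma isOpen_D : IsOpen {z : ℂ | z ∉ posAxis} := by
  have : IsClosed posAxis :=
    (isClosed_eq Complex.continuous_im continuous_const).inter
      (isClosed_le continuous_const Complex.continuous_re)
  exact this.isOpen_compl

lemma ker_diff (g : ℝ → ℂ) (hg : Measurable g) (hb : ∀ t, ‖g t‖ ≤ 1 + t ^ 2)
    (μ : Measure ℝ) [IsFiniteMeasure μ] {z : ℂ} (hz : z ∉ posAxis) :
    DifferentiableAt ℂ (kerI g μ) z := by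
  obtain ⟨c, hc, h⟩ := ker_bound hz
  have hne : ∀ w ∈ Metric.ball z c, ∀ t : ℝ, 1 - w * (t : ℂ) ^ 2 ≠ 0 := by
    intro w hw t
    rw [← norm_pos_iff]
    have h2 : 0 < c * (1 + t ^ 2) := by positivity
    exact lt_of_lt_of_le h2 (h w hw t)
  have key := hasDerivAt_integral_of_dominated_loc_of_deriv_le (μ := μ) (𝕜 := ℂ)
    (F := fun w (t : ℝ) => g t / (1 - w * (t : ℂ) ^ 2))
    (F' := fun w (t : ℝ) => (g t / (1 - w * (t : ℂ) ^ 2)) * ((t : ℂ) ^ 2 / (1 - w * (t : ℂ) ^ 2)))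
    (x₀ := z) (s := Metric.ball z c) (bound := fun _ => (1 / c) * (1 / c))
    (Metric.ball_mem_nhds z hc)
    (Filter.Eventually.of_forall fun w => (ker_meas g hg w).aestronglyMeasurable)
    (ker_integrable g hg hb μ hz)
    (by
      have h1 := ker_meas g hg z
      have h2 := ker_meas (fun t => (t : ℂ) ^ 2) (by fun_prop) z
      exact (h1.mul h2).aestronglyMeasurable)
    (by
      refine Filter.Eventually.of_forall fun t w hw => ?_
      rw [norm_mul]
      have h1 := ker_norm_le hb hc (h w hw t)
      have h2 := ker_norm_le (g := fun t => (t : ℂ) ^ 2) (by intro t; simp) hc (h w hw t)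
      gcongr)
    (integrable_const _)
    (by
      refine Filter.Eventually.of_forall fun t w hw => ?_
      have h1 := hne w hw t
      have h2 : HasDerivAt (fun w : ℂ => 1 - w * (t : ℂ) ^ 2) (-(t : ℂ) ^ 2) w := by
        simpa using ((hasDerivAt_id w).mul_const ((t : ℂ) ^ 2)).const_sub 1
      have h3 := (hasDerivAt_const w (g t)).div h2 h1
      have h4 : (g t / (1 - w * (t : ℂ) ^ 2)) * ((t : ℂ) ^ 2 / (1 - w * (t : ℂ) ^ 2)) =
          (0 * (1 - w * (t : ℂ) ^ 2) - g t * -(t : ℂ) ^ 2) / (1 - w * (t : ℂ) ^ 2) ^ 2 := by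
        field_simp
        ring
      rw [h4]
      exact h3)
  exact key.2.differentiableAt

lemma ker_conj (g : ℝ → ℂ) (hg : ∀ t, (starRingEnd ℂ) (g t) = g t) (μ : Measure ℝ) (z : ℂ) :
    kerI g μ (starRingEnd ℂ z) = starRingEnd ℂ (kerI g μ z) := by
  unfold kerI
  rw [← integral_conj]
  congr 1
  ext t
  simp [hg]

lemma im_integral_pos (μ : Measure ℝ) (hμ : μ ≠ 0) (f : ℝ → ℂ) (hf : Integrable f μ)
    (hpos : ∀ t, 0 < (f t).im) : 0 < (∫ t, f t ∂μ).im := by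
  have h1 : (∫ t, f t ∂μ).im = ∫ t, (f t).im ∂μ := (integral_im hf).symm
  rw [h1, integral_pos_iff_support_of_nonneg (fun t => (hpos t).le) hf.im]
  have : Function.support (fun t => (f t).im) = Set.univ := by
    ext t; simp [(hpos t).ne']
  change 0 < μ (Function.support (fun t => (f t).im))
  rw [this]
  simpa [pos_iff_ne_zero] using hμ

/-- the function `1 + M`. -/
def qf (μ : Measure ℝ) (z : ℂ) : ℂ := kerI (fun _ => 1) μ z

/-- the function `C(z)/z`. -/
def Ef (G : Measure ℝ) (z : ℂ) : ℂ := kerI (fun t => 1 + (t : ℂ) ^ 2) G z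

lemma b1 : ∀ t : ℝ, ‖(fun _ : ℝ => (1 : ℂ)) t‖ ≤ 1 + t ^ 2 := by
  intro t; simp; positivity

lemma b2 : ∀ t : ℝ, ‖(fun t : ℝ => (1 + (t : ℂ) ^ 2)) t‖ ≤ 1 + t ^ 2 := by
  intro t
  refine (norm_add_le _ _).trans ?_
  simp

lemma rectC_eq (G : Measure ℝ) (z : ℂ) : rectC G z = z * Ef G z := rfl

lemma Mt_eq (μ : Measure ℝ) [IsProbabilityMeasure μ] {z : ℂ} (hz : z ∉ posAxis) :
    Mt μ z = qf μ z - 1 := by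
  have h1 : ∀ t : ℝ, z * (t : ℂ) ^ 2 / (1 - z * (t : ℂ) ^ 2) = 1 / (1 - z * (t : ℂ) ^ 2) - 1 := by
    intro t
    have := ker_ne hz t
    field_simp
    ring
  unfold Mt
  simp_rw [h1]
  rw [integral_sub (ker_integrable (fun _ => 1) measurable_const b1 μ hz) (integrable_const _)]
  simp [qf, kerI]

lemma qf_diff (μ : Measure ℝ) [IsFiniteMeasure μ] {z : ℂ} (hz : z ∉ posAxis) :
    DifferentiableAt ℂ (qf μ) z := ker_diff _ measurable_const b1 μ hz

lemma Ef_diff (μ : Measure ℝ) [IsFiniteMeasure μ] {z : ℂ} (hz : z ∉ posAxis) :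
    DifferentiableAt ℂ (Ef μ) z := ker_diff _ (by fun_prop) b2 μ hz

lemma qf_conj (μ : Measure ℝ) (z : ℂ) : qf μ (starRingEnd ℂ z) = starRingEnd ℂ (qf μ z) :=
  ker_conj _ (by simp) μ z

lemma Ef_conj (μ : Measure ℝ) (z : ℂ) : Ef μ (starRingEnd ℂ z) = starRingEnd ℂ (Ef μ z) :=
  ker_conj _ (by simp) μ z

lemma notMem_of_im {z : ℂ} (hz : z.im ≠ 0) : z ∉ posAxis := fun h => hz h.1

lemma notMem_of_re {z : ℂ} (hz : z.re < 0) : z ∉ posAxis := fun h => absurd h.2 (not_le.2 hz)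

lemma im_inv_pos {d : ℂ} (hd : d.im < 0) : 0 < (1 / d).im := by
  have : d ≠ 0 := by rintro rfl; simp at hd
  rw [one_div, Complex.inv_im]
  have := Complex.normSq_pos.2 this
  exact div_pos (by linarith) this

lemma im_inv_neg {d : ℂ} (hd : 0 < d.im) : (1 / d).im < 0 := by
  have : d ≠ 0 := by rintro rfl; simp at hd
  rw [one_div, Complex.inv_im]
  have := Complex.normSq_pos.2 this
  exact div_neg_of_neg_of_pos (by linarith) this

lemma qf_im_nonneg (μ : Measure ℝ) [IsFiniteMeasure μ] {z : ℂ} (hz : 0 < z.im) :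
    0 ≤ (qf μ z).im := by
  have hI := ker_integrable (fun _ => 1) measurable_const b1 μ (notMem_of_im hz.ne')
  have h1 : (qf μ z).im = ∫ t : ℝ, ((1 : ℂ) / (1 - z * (t : ℂ) ^ 2)).im ∂μ := (integral_im hI).symm
  rw [h1]
  refine integral_nonneg fun t => ?_
  rcases eq_or_ne t 0 with rfl | ht
  · simp
  · apply le_of_lt
    apply im_inv_pos
    have h2 : (1 - z * (t : ℂ) ^ 2).im = -(z.im * t ^ 2) := by
      rw [← Complex.ofReal_pow, Complex.sub_im, Complex.im_mul_ofReal, Complex.one_im, zero_sub]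
    rw [h2]
    have : 0 < z.im * t ^ 2 := by positivity
    linarith

lemma zqf_im_pos (μ : Measure ℝ) [IsProbabilityMeasure μ] {z : ℂ} (hz : 0 < z.im) :
    0 < (z * qf μ z).im := by
  have hI := ker_integrable (fun _ => 1) measurable_const b1 μ (notMem_of_im hz.ne')
  have hz0 : z ≠ 0 := by rintro rfl; simp at hz
  have h1 : z * qf μ z = ∫ t : ℝ, z * (1 / (1 - z * (t : ℂ) ^ 2)) ∂μ := by
    rw [integral_const_mul]; rfl
  rw [h1]
  refine im_integral_pos μ (IsProbabilityMeasure.ne_zero μ) _ (hI.const_mul z) fun t => ?_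
  have h2 : z * (1 / (1 - z * (t : ℂ) ^ 2)) = 1 / (1 / z - ((t ^ 2 : ℝ) : ℂ)) := by
    have := ker_ne (notMem_of_im hz.ne') t
    push_cast
    field_simp
  rw [h2]
  apply im_inv_pos
  rw [Complex.sub_im, Complex.ofReal_im]
  linarith [im_inv_neg hz]

/-- Key positivity lemma. -/
lemma key_pos (G : Measure ℝ) [IsFiniteMeasure G] {a b h : ℂ} (hG : G ≠ 0) (ha : 0 < a.im)
    (hb : 0 ≤ b.im) (hh : h = a * b) (hD : h ∉ posAxis) : 0 < (a * Ef G h).im := by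
  have hI := ker_integrable (fun t => 1 + (t : ℂ) ^ 2) (by fun_prop) b2 G hD
  have ha0 : a ≠ 0 := by rintro rfl; simp at ha
  have h1 : a * Ef G h = ∫ t : ℝ, a * ((1 + (t : ℂ) ^ 2) / (1 - h * (t : ℂ) ^ 2)) ∂G := by
    rw [integral_const_mul]; rfl
  rw [h1]
  refine im_integral_pos G hG _ (hI.const_mul a) fun t => ?_
  have h2 : a * ((1 + (t : ℂ) ^ 2) / (1 - h * (t : ℂ) ^ 2)) =
      ((1 + t ^ 2 : ℝ) : ℂ) * (1 / (1 / a - b * ((t ^ 2 : ℝ) : ℂ))) := by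
    have h3 := ker_ne hD t
    have h4 : (1 / a - b * ((t ^ 2 : ℝ) : ℂ)) = (1 - h * (t : ℂ) ^ 2) / a := by
      rw [hh]; push_cast; field_simp
    rw [h4]; push_cast; field_simp
  rw [h2, Complex.im_ofReal_mul]
  refine mul_pos (by positivity) (im_inv_pos ?_)
  rw [Complex.sub_im, Complex.im_mul_ofReal]
  have h5 : 0 ≤ b.im * t ^ 2 := by positivity
  linarith [im_inv_neg ha]

lemma key_dich (G : Measure ℝ) [IsFiniteMeasure G] {a b h : ℂ} (ha : 0 < a.im)
    (hb : 0 ≤ b.im) (hh : h = a * b) (hD : h ∉ posAxis) :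
    a * Ef G h = 0 ∨ 0 < (a * Ef G h).im := by
  by_cases hG : G = 0
  · left; simp [hG, Ef, kerI]
  · right; exact key_pos G hG ha hb hh hD

lemma qf_neg (μ : Measure ℝ) [IsProbabilityMeasure μ] {x : ℝ} (hx : x < 0) :
    ∃ q : ℝ, 0 < q ∧ qf μ (x : ℂ) = q := by
  have hD : (x : ℂ) ∉ posAxis := notMem_of_re (by simpa using hx)
  have hI := ker_integrable (fun _ => 1) measurable_const b1 μ hD
  have hpos : ∀ t : ℝ, 0 < 1 - x * t ^ 2 := fun t => by nlinarith [sq_nonneg t]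
  refine ⟨(qf μ x).re, ?_, ?_⟩
  · have h1 : Complex.I * qf μ x = ∫ t : ℝ, Complex.I * (1 / (1 - (x : ℂ) * (t : ℂ) ^ 2)) ∂μ := by
      rw [integral_const_mul]; rfl
    have h2 : 0 < (Complex.I * qf μ x).im := by
      rw [h1]
      refine im_integral_pos μ (IsProbabilityMeasure.ne_zero μ) _ (hI.const_mul _) fun t => ?_
      have h3 : (1 / (1 - (x : ℂ) * (t : ℂ) ^ 2)) = ((1 / (1 - x * t ^ 2) : ℝ) : ℂ) := by push_cast; rfl
      rw [h3, Complex.im_mul_ofReal]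
      have := hpos t
      simp only [Complex.I_im, one_mul]
      positivity
    simpa using h2
  · have := qf_conj μ (x : ℂ)
    rw [Complex.conj_ofReal] at this
    exact (Complex.conj_eq_iff_re.1 this.symm).symm

lemma Ef_neg (μ : Measure ℝ) {x : ℝ} (hx : x < 0) :
    ∃ q : ℝ, 0 ≤ q ∧ Ef μ (x : ℂ) = q := by
  have hpos : ∀ t : ℝ, 0 < 1 - x * t ^ 2 := fun t => by nlinarith [sq_nonneg t]
  refine ⟨∫ t : ℝ, (1 + t ^ 2) / (1 - x * t ^ 2) ∂μ, integral_nonneg fun t => ?_, ?_⟩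
  · have := hpos t
    positivity
  · have h1 := integral_ofReal (𝕜 := ℂ) (μ := μ) (f := fun t : ℝ => (1 + t ^ 2) / (1 - x * t ^ 2))
    refine Eq.trans ?_ h1
    unfold Ef kerI
    congr 1
    ext t
    push_cast
    rfl

lemma re_bound {z : ℂ} (hz : z.re < 0) (t : ℝ) : ‖1 / (1 - z * (t : ℂ) ^ 2)‖ ≤ 1 := by
  have h1 : 1 ≤ ‖1 - z * (t : ℂ) ^ 2‖ := by
    refine le_trans ?_ (Complex.re_le_norm _)
    rw [← Complex.ofReal_pow, Complex.sub_re, Complex.re_mul_ofReal, Complex.one_re]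
    nlinarith [sq_nonneg t]
  rw [norm_div, norm_one, div_le_one (by linarith)]
  exact h1

lemma qf_tendsto (μ : Measure ℝ) [IsProbabilityMeasure μ] :
    Tendsto (qf μ) (𝓝[{z : ℂ | z.re < 0}] 0) (𝓝 1) := by
  have h := tendsto_integral_filter_of_dominated_convergence (μ := μ)
    (l := 𝓝[{z : ℂ | z.re < 0}] 0)
    (F := fun (z : ℂ) (t : ℝ) => 1 / (1 - z * (t : ℂ) ^ 2)) (f := fun _ => (1 : ℂ)) (fun _ => (1 : ℝ))
    (Filter.Eventually.of_forall fun w => (ker_meas _ measurable_const w).aestronglyMeasurable)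
    (by
      filter_upwards [self_mem_nhdsWithin] with z hz
      exact Filter.Eventually.of_forall fun t => re_bound hz t)
    (integrable_const _)
    (by
      refine Filter.Eventually.of_forall fun t => ?_
      have h1 : ContinuousAt (fun z : ℂ => 1 / (1 - z * (t : ℂ) ^ 2)) 0 := by
        refine ContinuousAt.div (by fun_prop) (by fun_prop) (by simp)
      have h2 := h1.tendsto
      simp only [zero_mul, sub_zero, div_one] at h2
      exact h2.mono_left nhdsWithin_le_nhds)
  simp only [integral_const, probReal_univ, one_smul] at h
  exact h

lemma rectC_tendsto (G : Measure ℝ) [IsFiniteMeasure G] :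
    Tendsto (rectC G) (𝓝[{z : ℂ | z.re < 0}] 0) (𝓝 0) := by
  have h := tendsto_integral_filter_of_dominated_convergence (μ := G)
    (l := 𝓝[{z : ℂ | z.re < 0}] 0)
    (F := fun (z : ℂ) (t : ℝ) => z * ((1 + (t : ℂ) ^ 2) / (1 - z * (t : ℂ) ^ 2)))
    (f := fun _ => (0 : ℂ)) (fun _ => (3 : ℝ))
    (Filter.Eventually.of_forall fun w =>
      ((ker_meas _ (by fun_prop) w).const_mul w).aestronglyMeasurable)
    (by
      have hball : ∀ᶠ z : ℂ in 𝓝[{z : ℂ | z.re < 0}] 0, ‖z‖ < 1 := by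
        refine nhdsWithin_le_nhds ?_
        filter_upwards [Metric.ball_mem_nhds (0 : ℂ) one_pos] with z hz
        simpa using hz
      filter_upwards [self_mem_nhdsWithin, hball] with z hz hz1
      refine Filter.Eventually.of_forall fun t => ?_
      have hne := ker_ne (notMem_of_re hz) t
      have h1 : z * ((1 + (t : ℂ) ^ 2) / (1 - z * (t : ℂ) ^ 2)) =
          z * (1 / (1 - z * (t : ℂ) ^ 2)) + (1 / (1 - z * (t : ℂ) ^ 2) - 1) := by
        field_simp
        ring
      rw [h1]
      have h2 := re_bound hz t
      have h3 := norm_add_le (z * (1 / (1 - z * (t : ℂ) ^ 2))) (1 / (1 - z * (t : ℂ) ^ 2) - 1)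
      have h4 := norm_sub_le (1 / (1 - z * (t : ℂ) ^ 2)) 1
      rw [norm_mul] at h3
      rw [norm_one] at h4
      nlinarith [norm_nonneg z, norm_nonneg (1 / (1 - z * (t : ℂ) ^ 2))])
    (integrable_const _)
    (by
      refine Filter.Eventually.of_forall fun t => ?_
      have h1 : ContinuousAt (fun z : ℂ => z * ((1 + (t : ℂ) ^ 2) / (1 - z * (t : ℂ) ^ 2))) 0 := by
        refine continuousAt_id.mul (ContinuousAt.div (by fun_prop) (by fun_prop) (by simp))
      have h2 := h1.tendsto
      simp only [zero_mul] at h2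
      exact h2.mono_left nhdsWithin_le_nhds)
  simp only [integral_const_mul, integral_zero] at h
  exact h

/-- `1 + λ M`. -/
def rf (l : ℝ) (μ : Measure ℝ) (z : ℂ) : ℂ := 1 - l + l * qf μ z

/-- `H`. -/
def hf (l : ℝ) (μ : Measure ℝ) (z : ℂ) : ℂ := z * qf μ z * rf l μ z

/-- `C ∘ H`. -/
def cf (l : ℝ) (G ρ : Measure ℝ) (z : ℂ) : ℂ := rectC G (hf l ρ z)

/-- first factor of `ω₂ z / z`. -/
def af (l : ℝ) (G ρ : Measure ℝ) (z : ℂ) : ℂ := qf ρ z / (qf ρ z - cf l G ρ z)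

/-- second factor of `ω₂ z / z`. -/
def bf (l : ℝ) (G ρ : Measure ℝ) (z : ℂ) : ℂ := rf l ρ z / (rf l ρ z - l * cf l G ρ z)

/-- the subordination function. -/
def om (l : ℝ) (G ρ : Measure ℝ) (z : ℂ) : ℂ := z * af l G ρ z * bf l G ρ z

lemma Ht_eq (l : ℝ) (μ : Measure ℝ) [IsProbabilityMeasure μ] {z : ℂ} (hz : z ∉ posAxis) :
    Ht l μ z = hf l μ z := by
  unfold Ht hf rf
  rw [Mt_eq μ hz]
  ring

lemma om_eq (l : ℝ) (G ρ : Measure ℝ) [IsProbabilityMeasure ρ] {z : ℂ} (hz : z ∉ posAxis) :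
    Ht l ρ z / Tfun l (Mt ρ z - rectC G (Ht l ρ z)) = om l G ρ z := by
  rw [Ht_eq l ρ hz, Mt_eq ρ hz]
  have : Tfun l (qf ρ z - 1 - rectC G (hf l ρ z)) =
    (qf ρ z - cf l G ρ z) * (rf l ρ z - l * cf l G ρ z) := by
    unfold Tfun cf rf; ring
  rw [this]
  unfold om af bf hf
  rw [mul_assoc z, mul_assoc z, div_mul_div_comm, mul_div_assoc]

lemma inv_one_sub {u : ℂ} (hu : u = 0 ∨ 0 < u.im) : 1 - u ≠ 0 ∧ 0 ≤ (1 / (1 - u)).im := by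
  rcases hu with rfl | hu
  · simp
  · have h1 : (1 - u).im < 0 := by simpa using hu
    refine ⟨fun h => by simp [h] at h1, (im_inv_pos h1).le⟩

lemma rf_im_nonneg {l : ℝ} (hl : l ∈ Set.Ioo (0 : ℝ) 1) (μ : Measure ℝ) [IsFiniteMeasure μ]
    {z : ℂ} (hz : 0 < z.im) : 0 ≤ (rf l μ z).im := by
  have := qf_im_nonneg μ hz
  have h2 := mul_nonneg hl.1.le this
  simpa [rf] using h2

lemma zrf_im_pos {l : ℝ} (hl : l ∈ Set.Ioo (0 : ℝ) 1) (μ : Measure ℝ) [IsProbabilityMeasure μ]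
    {z : ℂ} (hz : 0 < z.im) : 0 < (z * rf l μ z).im := by
  have h1 := zqf_im_pos μ hz
  have h2 : z * rf l μ z = ((1 - l : ℝ) : ℂ) * z + (l : ℂ) * (z * qf μ z) := by
    unfold rf; push_cast; ring
  rw [h2, Complex.add_im, Complex.im_ofReal_mul, Complex.im_ofReal_mul]
  have := mul_pos hl.1 h1
  have := mul_pos (sub_pos.2 hl.2) hz
  linarith

lemma hf_up {l : ℝ} (hl : l ∈ Set.Ioo (0 : ℝ) 1) (μ : Measure ℝ) [IsProbabilityMeasure μ]
    {z : ℂ} (hz : 0 < z.im) : hf l μ z ∉ posAxis := by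
  rintro ⟨h1, h2⟩
  have ha := zqf_im_pos μ hz
  have hb := rf_im_nonneg hl μ hz
  have hr : rf l μ z ≠ 0 := by
    intro h; have := zrf_im_pos hl μ hz; simp [h] at this
  unfold hf at h1 h2
  set a := z * qf μ z
  set b := rf l μ z
  rw [Complex.mul_im] at h1
  rw [Complex.mul_re] at h2
  have hbi : b.im = 0 := by
    by_contra hne
    have hb' : 0 < b.im := lt_of_le_of_ne hb (Ne.symm hne)
    have h3 : 0 < a.im ^ 2 * b.im + a.re ^ 2 * b.im := by positivity
    have h4 : a.im * (a.re * b.re - a.im * b.im) = -(a.im ^ 2 * b.im + a.re ^ 2 * b.im) := by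
      linear_combination a.re * h1
    have h5 := mul_nonneg ha.le h2
    linarith
  rw [hbi] at h1
  simp at h1
  rcases h1 with h1 | h1
  · exact ha.ne' h1
  · exact hr (Complex.ext h1 hbi)

lemma up_facts {l : ℝ} (hl : l ∈ Set.Ioo (0 : ℝ) 1) (G ρ : Measure ℝ) [IsFiniteMeasure G]
    [IsProbabilityMeasure ρ] {z : ℂ} (hz : 0 < z.im) :
    qf ρ z ≠ 0 ∧ rf l ρ z ≠ 0 ∧ qf ρ z - cf l G ρ z ≠ 0 ∧ rf l ρ z - l * cf l G ρ z ≠ 0 ∧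
    0 ≤ (af l G ρ z).im ∧ 0 ≤ (bf l G ρ z).im := by
  have hq : qf ρ z ≠ 0 := by
    intro h; have := zqf_im_pos ρ hz; simp [h] at this
  have hr : rf l ρ z ≠ 0 := by
    intro h; have := zrf_im_pos hl ρ hz; simp [h] at this
  have hD := hf_up hl ρ hz
  have k1 := key_dich G (zrf_im_pos hl ρ hz) (qf_im_nonneg ρ hz) (h := hf l ρ z)
    (by unfold hf; ring) hD
  have k2 := key_dich G (zqf_im_pos ρ hz) (rf_im_nonneg hl ρ hz) (h := hf l ρ z)
    (by unfold hf; ring) hD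
  have k2' : (l : ℂ) * (z * qf ρ z * Ef G (hf l ρ z)) = 0 ∨
      0 < ((l : ℂ) * (z * qf ρ z * Ef G (hf l ρ z))).im := by
    rcases k2 with h | h
    · left; rw [h, mul_zero]
    · right; rw [Complex.im_ofReal_mul]; exact mul_pos hl.1 h
  have ec : cf l G ρ z = z * qf ρ z * rf l ρ z * Ef G (hf l ρ z) := rfl
  have e1 : qf ρ z - cf l G ρ z = qf ρ z * (1 - z * rf l ρ z * Ef G (hf l ρ z)) := by
    rw [ec]; ring
  have e2 : rf l ρ z - l * cf l G ρ z = rf l ρ z * (1 - l * (z * qf ρ z * Ef G (hf l ρ z))) := by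
    rw [ec]; ring
  obtain ⟨n1, p1⟩ := inv_one_sub k1
  obtain ⟨n2, p2⟩ := inv_one_sub k2'
  refine ⟨hq, hr, ?_, ?_, ?_, ?_⟩
  · rw [e1]; exact mul_ne_zero hq n1
  · rw [e2]; exact mul_ne_zero hr n2
  · unfold af; rw [e1]
    convert p1 using 2
    field_simp
  · unfold bf; rw [e2]
    convert p2 using 2
    field_simp

lemma neg_facts {l : ℝ} (hl : l ∈ Set.Ioo (0 : ℝ) 1) (G ρ : Measure ℝ)
    [IsProbabilityMeasure ρ] {x : ℝ} (hx : x < 0) :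
    ∃ q r h c : ℝ, 0 < q ∧ 0 < r ∧ h < 0 ∧ c ≤ 0 ∧ r = 1 - l + l * q ∧ h = x * q * r ∧
      qf ρ x = q ∧ rf l ρ x = r ∧ hf l ρ x = h ∧ cf l G ρ x = c := by
  obtain ⟨q, hq, e1⟩ := qf_neg ρ hx
  have hr : 0 < 1 - l + l * q := by nlinarith [hl.1, hl.2, mul_pos hl.1 hq]
  have e2 : rf l ρ x = ((1 - l + l * q : ℝ) : ℂ) := by unfold rf; rw [e1]; push_cast; ring
  have hh : x * q * (1 - l + l * q) < 0 := mul_neg_of_neg_of_pos (mul_neg_of_neg_of_pos hx hq) hr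
  have e3 : hf l ρ x = ((x * q * (1 - l + l * q) : ℝ) : ℂ) := by
    unfold hf; rw [e1, e2]; push_cast; ring
  obtain ⟨e, he, e4⟩ := Ef_neg G hh
  refine ⟨q, 1 - l + l * q, x * q * (1 - l + l * q), x * q * (1 - l + l * q) * e, hq, hr, hh,
    mul_nonpos_of_nonpos_of_nonneg hh.le he, rfl, rfl, e1, e2, e3, ?_⟩
  unfold cf
  rw [rectC_eq, e3, e4, ← Complex.ofReal_mul]

lemma rf_conj (l : ℝ) (μ : Measure ℝ) (z : ℂ) :
    rf l μ (starRingEnd ℂ z) = starRingEnd ℂ (rf l μ z) := by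
  simp [rf, qf_conj]

lemma hf_conj (l : ℝ) (μ : Measure ℝ) (z : ℂ) :
    hf l μ (starRingEnd ℂ z) = starRingEnd ℂ (hf l μ z) := by
  simp [hf, qf_conj, rf_conj]

lemma cf_conj (l : ℝ) (G μ : Measure ℝ) (z : ℂ) :
    cf l G μ (starRingEnd ℂ z) = starRingEnd ℂ (cf l G μ z) := by
  simp [cf, hf_conj, rectC_eq, Ef_conj]

lemma om_conj (l : ℝ) (G μ : Measure ℝ) (z : ℂ) :
    om l G μ (starRingEnd ℂ z) = starRingEnd ℂ (om l G μ z) := by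
  simp [om, af, bf, cf_conj, qf_conj, rf_conj]

lemma conj_notMem {z : ℂ} (hz : starRingEnd ℂ z ∉ posAxis) : z ∉ posAxis := by
  intro h
  apply hz
  exact ⟨by simpa using h.1, by simpa using h.2⟩

lemma D_cases {z : ℂ} (hz : z ∉ posAxis) :
    0 < z.im ∨ 0 < (starRingEnd ℂ z).im ∨ ∃ x : ℝ, x < 0 ∧ z = x := by
  rcases lt_trichotomy z.im 0 with h | h | h
  · right; left; simpa using h
  · right; right
    refine ⟨z.re, ?_, Complex.ext (by simp) (by simpa using h)⟩
    by_contra h2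
    exact hz ⟨h, not_lt.1 h2⟩
  · left; exact h

lemma D_facts {l : ℝ} (hl : l ∈ Set.Ioo (0 : ℝ) 1) (G ρ : Measure ℝ) [IsFiniteMeasure G]
    [IsProbabilityMeasure ρ] {z : ℂ} (hz : z ∉ posAxis) :
    hf l ρ z ∉ posAxis ∧ qf ρ z ≠ 0 ∧ rf l ρ z ≠ 0 ∧ qf ρ z - cf l G ρ z ≠ 0 ∧
      rf l ρ z - l * cf l G ρ z ≠ 0 := by
  rcases D_cases hz with h | h | ⟨x, hx, rfl⟩
  · obtain ⟨h1, h2, h3, h4, -, -⟩ := up_facts hl G ρ h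
    exact ⟨hf_up hl ρ h, h1, h2, h3, h4⟩
  · obtain ⟨h1, h2, h3, h4, -, -⟩ := up_facts hl G ρ h
    have h0 := hf_up hl ρ h
    rw [hf_conj] at h0
    rw [qf_conj] at h1 h3
    rw [rf_conj] at h2 h4
    rw [cf_conj, ← map_sub] at h3
    rw [cf_conj, ← Complex.conj_ofReal l, ← map_mul, ← map_sub] at h4
    exact ⟨conj_notMem h0, by simpa using h1, by simpa using h2,
      (map_ne_zero _).1 h3, (map_ne_zero _).1 h4⟩
  · obtain ⟨q, r, h, c, hq, hr, hh, hc, -, -, e1, e2, e3, e4⟩ := neg_facts hl G ρ hx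
    rw [e1, e2, e3, e4]
    have := hl.1
    have h5 : l * c ≤ 0 := mul_nonpos_of_nonneg_of_nonpos hl.1.le hc
    refine ⟨notMem_of_re (by simpa using hh), by exact_mod_cast hq.ne', by exact_mod_cast hr.ne', ?_, ?_⟩
    · have : q - c ≠ 0 := by linarith
      exact_mod_cast this
    · have : r - l * c ≠ 0 := by linarith
      exact_mod_cast this

lemma om_neg {l : ℝ} (hl : l ∈ Set.Ioo (0 : ℝ) 1) (G ρ : Measure ℝ)
    [IsProbabilityMeasure ρ] {x : ℝ} (hx : x < 0) :
    ∃ w : ℝ, w < 0 ∧ om l G ρ x = w := by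
  obtain ⟨q, r, h, c, hq, hr, hh, hc, -, -, e1, e2, e3, e4⟩ := neg_facts hl G ρ hx
  have h5 : l * c ≤ 0 := mul_nonpos_of_nonneg_of_nonpos hl.1.le hc
  refine ⟨x * (q / (q - c)) * (r / (r - l * c)), ?_, ?_⟩
  · have h1 : 0 < q - c := by linarith
    have h2 : 0 < r - l * c := by linarith
    exact mul_neg_of_neg_of_pos (mul_neg_of_neg_of_pos hx (by positivity)) (by positivity)
  · unfold om af bf
    rw [e1, e2, e4]; push_cast; ring

lemma rf_diff (l : ℝ) (μ : Measure ℝ) [IsFiniteMeasure μ] {z : ℂ} (hz : z ∉ posAxis) :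
    DifferentiableAt ℂ (rf l μ) z := by
  have := qf_diff μ hz
  unfold rf
  fun_prop

lemma hf_diff (l : ℝ) (μ : Measure ℝ) [IsFiniteMeasure μ] {z : ℂ} (hz : z ∉ posAxis) :
    DifferentiableAt ℂ (hf l μ) z := by
  have := qf_diff μ hz
  have := rf_diff l μ hz
  unfold hf
  fun_prop

lemma cf_diff {l : ℝ} (hl : l ∈ Set.Ioo (0 : ℝ) 1) (G ρ : Measure ℝ) [IsFiniteMeasure G]
    [IsProbabilityMeasure ρ] {z : ℂ} (hz : z ∉ posAxis) :
    DifferentiableAt ℂ (cf l G ρ) z := by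
  have h1 := hf_diff l ρ hz
  have h2 := (Ef_diff G (D_facts hl G ρ hz).1).comp z h1
  exact h1.mul h2

lemma af_diff {l : ℝ} (hl : l ∈ Set.Ioo (0 : ℝ) 1) (G ρ : Measure ℝ) [IsFiniteMeasure G]
    [IsProbabilityMeasure ρ] {z : ℂ} (hz : z ∉ posAxis) :
    DifferentiableAt ℂ (af l G ρ) z :=
  (qf_diff ρ hz).div ((qf_diff ρ hz).sub (cf_diff hl G ρ hz)) (D_facts hl G ρ hz).2.2.2.1

lemma bf_diff {l : ℝ} (hl : l ∈ Set.Ioo (0 : ℝ) 1) (G ρ : Measure ℝ) [IsFiniteMeasure G]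
    [IsProbabilityMeasure ρ] {z : ℂ} (hz : z ∉ posAxis) :
    DifferentiableAt ℂ (bf l G ρ) z :=
  (rf_diff l ρ hz).div ((rf_diff l ρ hz).sub ((cf_diff hl G ρ hz).const_mul _))
    (D_facts hl G ρ hz).2.2.2.2

lemma om_diff {l : ℝ} (hl : l ∈ Set.Ioo (0 : ℝ) 1) (G ρ : Measure ℝ) [IsFiniteMeasure G]
    [IsProbabilityMeasure ρ] {z : ℂ} (hz : z ∉ posAxis) :
    DifferentiableAt ℂ (om l G ρ) z :=
  (differentiableAt_id.mul (af_diff hl G ρ hz)).mul (bf_diff hl G ρ hz)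

lemma analytic_D {f : ℂ → ℂ} (hf : ∀ z, z ∉ posAxis → DifferentiableAt ℂ f z) :
    AnalyticOnNhd ℂ f {z : ℂ | z ∉ posAxis} :=
  DifferentiableOn.analyticOnNhd (fun z hz => (hf z hz).differentiableWithinAt) isOpen_D

/-- analyticity of the two sides of the subordination identity. -/
lemma lhs_an {l : ℝ} (hl : l ∈ Set.Ioo (0 : ℝ) 1) (G ν ρ : Measure ℝ) [IsFiniteMeasure G]
    [IsProbabilityMeasure ρ] [IsProbabilityMeasure ν] {z : ℂ} (hz : z ∉ posAxis)
    (hw : om l G ρ z ∉ posAxis) :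
    AnalyticAt ℂ (fun z => qf ν (om l G ρ z)) z := by
  have h1 := analytic_D (fun _ hz => om_diff hl G ρ hz) z hz
  have h2 := analytic_D (fun z hz => qf_diff ν hz) _ hw
  exact AnalyticAt.comp h2 h1

lemma rhs_an {l : ℝ} (hl : l ∈ Set.Ioo (0 : ℝ) 1) (G ρ : Measure ℝ) [IsFiniteMeasure G]
    [IsProbabilityMeasure ρ] {z : ℂ} (hz : z ∉ posAxis) :
    AnalyticAt ℂ (fun z => qf ρ z - cf l G ρ z) z :=
  analytic_D (fun z hz => (qf_diff ρ hz).sub (cf_diff hl G ρ hz)) z hz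

/-- A convex sector around the negative axis. -/
def Sec : Set ℂ := {z : ℂ | |z.im| < - z.re}

lemma Sec_convex : Convex ℝ Sec := by
  have : Sec = {z : ℂ | z.im < -z.re} ∩ {z : ℂ | -z.im < -z.re} := by
    ext z
    simp only [Sec, Set.mem_ofPred_eq, Set.mem_inter_iff, abs_lt]
    constructor
    · rintro ⟨h1, h2⟩; constructor <;> linarith
    · rintro ⟨h1, h2⟩; constructor <;> linarith
  intro x hx y hy a b ha hb hab
  rw [this] at hx hy ⊢
  obtain ⟨hx1, hx2⟩ := hx
  obtain ⟨hy1, hy2⟩ := hy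
  simp only [Set.mem_ofPred_eq, Set.mem_inter_iff, Complex.add_re, Complex.add_im,
    Complex.real_smul, Complex.im_ofReal_mul, Complex.re_ofReal_mul] at *
  have hpos : 0 < a ∨ 0 < b := by
    by_contra hcon
    push Not at hcon
    linarith
  constructor <;>
  · rcases hpos with h | h <;> nlinarith

lemma Sec_re {z : ℂ} (hz : z ∈ Sec) : z.re < 0 := by
  have h : |z.im| < -z.re := hz
  have := abs_nonneg z.im
  linarith

lemma Sec_mul {z u : ℂ} (hz : z ∈ Sec) (hu : |u.im| < u.re) : (z * u).re < 0 := by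
  have h : |z.im| < -z.re := hz
  rw [Complex.mul_re]
  have h1 : |z.im * u.im| ≤ (-z.re) * u.re := by
    rw [abs_mul]
    exact mul_le_mul h.le hu.le (abs_nonneg _) (by linarith [abs_nonneg z.im])
  have h2 : |z.im| * |u.im| < (-z.re) * u.re := by
    have := abs_nonneg z.im
    have := abs_nonneg u.im
    nlinarith
  rw [← abs_mul] at h2
  have := neg_abs_le (z.im * u.im)
  linarith

lemma near_one : {u : ℂ | |u.im| < u.re} ∈ 𝓝 (1 : ℂ) := by
  have : IsOpen {u : ℂ | |u.im| < u.re} :=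
    isOpen_lt (Complex.continuous_im.abs) Complex.continuous_re
  exact this.mem_nhds (by simp)

lemma cone_tendsto {f : ℂ → ℂ} (hf : Tendsto f (𝓝[Sec] 0) (𝓝 1)) :
    Tendsto (fun z => z * f z) (𝓝[Sec] 0) (𝓝[{z : ℂ | z.re < 0}] 0) := by
  refine tendsto_nhdsWithin_iff.2 ⟨?_, ?_⟩
  · have h1 : Tendsto (fun z : ℂ => z) (𝓝[Sec] 0) (𝓝 0) := tendsto_id.mono_left nhdsWithin_le_nhds
    simpa using h1.mul hf
  · filter_upwards [self_mem_nhdsWithin, hf near_one] with z hz hz2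
    exact Sec_mul hz hz2

lemma limits (l : ℝ) (G ρ : Measure ℝ) [IsFiniteMeasure G] [IsProbabilityMeasure ρ] :
    Tendsto (af l G ρ) (𝓝[Sec] 0) (𝓝 1) ∧ Tendsto (bf l G ρ) (𝓝[Sec] 0) (𝓝 1) := by
  have hq : Tendsto (qf ρ) (𝓝[Sec] 0) (𝓝 1) :=
    (qf_tendsto ρ).mono_left (nhdsWithin_mono _ fun z hz => Sec_re hz)
  have hr : Tendsto (rf l ρ) (𝓝[Sec] 0) (𝓝 1) := by
    have := (hq.const_mul (l : ℂ)).const_add (1 - (l : ℂ))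
    simp only [mul_one, sub_add_cancel] at this
    exact this
  have hqr : Tendsto (fun z => qf ρ z * rf l ρ z) (𝓝[Sec] 0) (𝓝 1) := by
    simpa using hq.mul hr
  have hh : Tendsto (hf l ρ) (𝓝[Sec] 0) (𝓝[{z : ℂ | z.re < 0}] 0) := by
    refine (cone_tendsto hqr).congr fun z => ?_
    unfold hf; ring
  have hc : Tendsto (cf l G ρ) (𝓝[Sec] 0) (𝓝 0) := (rectC_tendsto G).comp hh
  constructor
  · have := hq.div (hq.sub hc) (by simp)
    simp only [sub_zero, div_one] at this
    exact this
  · have := hr.div (hr.sub (hc.const_mul (l : ℂ))) (by simp)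
    simp only [mul_zero, sub_zero, div_one] at this
    exact this

lemma om_tendsto (l : ℝ) (G ρ : Measure ℝ) [IsFiniteMeasure G] [IsProbabilityMeasure ρ] :
    Tendsto (om l G ρ) (𝓝[Sec] 0) (𝓝[{z : ℂ | z.re < 0}] 0) := by
  obtain ⟨h1, h2⟩ := limits l G ρ
  have h3 : Tendsto (fun z => af l G ρ z * bf l G ρ z) (𝓝[Sec] 0) (𝓝 1) := by
    simpa using h1.mul h2
  refine (cone_tendsto h3).congr fun z => ?_
  unfold om; ring

lemma ofReal_Sec : Tendsto (fun x : ℝ => (x : ℂ)) (𝓝[<] 0) (𝓝[Sec] 0) := by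
  refine tendsto_nhdsWithin_iff.2 ⟨?_, ?_⟩
  · have : Tendsto (fun x : ℝ => (x : ℂ)) (𝓝 0) (𝓝 ((0 : ℝ) : ℂ)) :=
      Complex.continuous_ofReal.tendsto 0
    simpa using this.mono_left nhdsWithin_le_nhds
  · filter_upwards [self_mem_nhdsWithin] with x hx
    have hx' : x < 0 := hx
    simpa [Sec] using hx'

/-- The identity on the negative axis near zero. -/
lemma ident_neg {l : ℝ} (hl : l ∈ Set.Ioo (0 : ℝ) 1) (G ν ρ : Measure ℝ) [IsFiniteMeasure G]
    [IsProbabilityMeasure ρ] [IsProbabilityMeasure ν] {x : ℝ} (hx : x < 0)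
    (h : Ht l ρ (x : ℂ) =
      Ht l ν (Ht l ρ (x : ℂ) / Tfun l (Mt ρ (x : ℂ) - rectC G (Ht l ρ (x : ℂ))))) :
    qf ν (om l G ρ x) = qf ρ x - cf l G ρ x := by
  have hD : (x : ℂ) ∉ posAxis := notMem_of_re (by simpa using hx)
  obtain ⟨w, hw, ew⟩ := om_neg hl G ρ hx
  have hDw : (w : ℂ) ∉ posAxis := notMem_of_re (by simpa using hw)
  rw [om_eq l G ρ hD, ew, Ht_eq l ρ hD, Ht_eq l ν hDw] at h
  obtain ⟨q, r, h', c, hq, hr, hh, hc, er, eh, e1, e2, e3, e4⟩ := neg_facts hl G ρ hx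
  obtain ⟨Q, hQ, eQ⟩ := qf_neg ν hw
  rw [ew, eQ, e1, e4]
  have h5 : l * c ≤ 0 := mul_nonpos_of_nonneg_of_nonpos hl.1.le hc
  have hw2 : (om l G ρ x) = ((x * (q / (q - c)) * (r / (r - l * c)) : ℝ) : ℂ) := by
    unfold om af bf
    rw [e1, e2, e4]; push_cast; ring
  rw [ew] at hw2
  have hw3 : w = x * (q / (q - c)) * (r / (r - l * c)) := by exact_mod_cast hw2
  have n1 : 0 < q - c := by linarith
  have n2 : 0 < r - l * c := by linarith
  have hw4 : h' = w * ((q - c) * (r - l * c)) := by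
    have n1' := n1.ne'
    have n2' := n2.ne'
    rw [hw3, eh, mul_assoc x, mul_assoc x, div_mul_div_comm, mul_assoc x,
      div_mul_cancel₀ _ (mul_ne_zero n1' n2')]
  rw [e3] at h
  unfold hf rf at h
  rw [eQ] at h
  have h6 : h' = w * (Q * (1 - l + l * Q)) := by
    have : (h' : ℂ) = ((w * (Q * (1 - l + l * Q)) : ℝ) : ℂ) := by rw [h]; push_cast; ring
    exact_mod_cast this
  have h7 : (q - c) * (r - l * c) = Q * (1 - l + l * Q) :=
    mul_left_cancel₀ hw.ne (hw4.symm.trans h6)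
  have h8 : (Q - (q - c)) * (1 - l + l * (Q + (q - c))) = 0 := by
    rw [er] at h7
    linear_combination -h7
  have h9 : 0 < 1 - l + l * (Q + (q - c)) := by
    have := mul_pos hl.1 (add_pos hQ n1)
    linarith [hl.2]
  rcases mul_eq_zero.1 h8 with h | h
  · have : Q = q - c := by linarith
    rw [this]; push_cast; rfl
  · exact absurd h h9.ne'

lemma ab_im {z A B : ℂ} (hz : 0 < z.im) (hA : 0 ≤ A.im) (hB : 0 ≤ B.im) (h1 : 0 < (z * A).im)
    (h2 : 0 < (z * A * B).im) : 0 ≤ (A * B).im := by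
  have e1 : (z * A).im * A.re - (z * A).re * A.im = z.im * Complex.normSq A := by
    rw [Complex.normSq_apply, Complex.mul_im, Complex.mul_re]; ring
  have e2 : 0 ≤ z.im * Complex.normSq A := mul_nonneg hz.le (Complex.normSq_nonneg _)
  rw [Complex.mul_im (z * A) B] at h2
  rw [Complex.mul_im]
  have e3 := mul_nonneg e2 hB
  rw [← e1] at e3
  have e4 := mul_nonneg h2.le hA
  by_contra hcon
  push Not at hcon
  have e5 := mul_pos h1 (neg_pos.2 hcon)
  nlinarith

/-- The good set for the continuity argument. -/
def Sg (l : ℝ) (G ν ρ : Measure ℝ) : Set ℂ :=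
  {z : ℂ | 0 < z.im ∧ 0 < (z * af l G ρ z).im ∧ 0 < (om l G ρ z).im ∧
    (fun z => qf ν (om l G ρ z)) =ᶠ[𝓝 z] (fun z => qf ρ z - cf l G ρ z)}

lemma Sg_open {l : ℝ} (hl : l ∈ Set.Ioo (0 : ℝ) 1) (G ν ρ : Measure ℝ) [IsFiniteMeasure G]
    [IsProbabilityMeasure ρ] : IsOpen (Sg l G ν ρ) := by
  rw [isOpen_iff_mem_nhds]
  rintro z ⟨h1, h2, h3, h4⟩
  have hD := notMem_of_im h1.ne'
  have c1 : ContinuousAt (fun z : ℂ => z.im) z := Complex.continuous_im.continuousAt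
  have c2 : ContinuousAt (fun z : ℂ => (z * af l G ρ z).im) z :=
    Complex.continuous_im.continuousAt.comp (continuousAt_id.mul (af_diff hl G ρ hD).continuousAt)
  have c3 : ContinuousAt (fun z : ℂ => (om l G ρ z).im) z :=
    Complex.continuous_im.continuousAt.comp (om_diff hl G ρ hD).continuousAt
  filter_upwards [c1.eventually (lt_mem_nhds h1), c2.eventually (lt_mem_nhds h2),
    c3.eventually (lt_mem_nhds h3), h4.eventually_nhds] with w w1 w2 w3 w4
  exact ⟨w1, w2, w3, w4⟩

lemma af_ne {l : ℝ} (hl : l ∈ Set.Ioo (0 : ℝ) 1) (G ρ : Measure ℝ) [IsFiniteMeasure G]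
    [IsProbabilityMeasure ρ] {z : ℂ} (hz : z ∉ posAxis) : af l G ρ z ≠ 0 ∧ bf l G ρ z ≠ 0 := by
  obtain ⟨-, h1, h2, h3, h4⟩ := D_facts hl G ρ hz
  exact ⟨div_ne_zero h1 h3, div_ne_zero h2 h4⟩

/-- `H_ρ = ω₂ · T(P)`. -/
lemma hf_om {l : ℝ} (hl : l ∈ Set.Ioo (0 : ℝ) 1) (G ν ρ : Measure ℝ) [IsFiniteMeasure G]
    [IsProbabilityMeasure ρ] {z : ℂ} (hz : z ∉ posAxis)
    (h : qf ν (om l G ρ z) = qf ρ z - cf l G ρ z) : hf l ν (om l G ρ z) = hf l ρ z := by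
  obtain ⟨-, h1, h2, h3, h4⟩ := D_facts hl G ρ hz
  have e : rf l ν (om l G ρ z) = rf l ρ z - l * cf l G ρ z := by
    unfold rf; rw [h]; ring
  unfold hf
  rw [e, h]
  unfold om af bf
  rw [mul_assoc, mul_assoc z, mul_assoc z, div_mul_div_comm, mul_assoc z,
    div_mul_cancel₀ _ (mul_ne_zero h3 h4)]

lemma Sg_closed {l : ℝ} (hl : l ∈ Set.Ioo (0 : ℝ) 1) (G ν ρ : Measure ℝ) [IsFiniteMeasure G]
    [IsProbabilityMeasure ρ] [IsProbabilityMeasure ν] :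
    closure (Sg l G ν ρ) ∩ {z : ℂ | 0 < z.im} ⊆ Sg l G ν ρ := by
  rintro z ⟨hcl, hz⟩
  have hz : 0 < z.im := hz
  have hD := notMem_of_im hz.ne'
  by_contra hnot
  have hne : (𝓝[Sg l G ν ρ] z).NeBot := mem_closure_iff_nhdsWithin_neBot.1 hcl
  have ta : Tendsto (af l G ρ) (𝓝[Sg l G ν ρ] z) (𝓝 (af l G ρ z)) :=
    (af_diff hl G ρ hD).continuousAt.tendsto.mono_left nhdsWithin_le_nhds
  have tb : Tendsto (bf l G ρ) (𝓝[Sg l G ν ρ] z) (𝓝 (bf l G ρ z)) :=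
    (bf_diff hl G ρ hD).continuousAt.tendsto.mono_left nhdsWithin_le_nhds
  have to' : Tendsto (om l G ρ) (𝓝[Sg l G ν ρ] z) (𝓝 (om l G ρ z)) :=
    (om_diff hl G ρ hD).continuousAt.tendsto.mono_left nhdsWithin_le_nhds
  have tz : Tendsto (fun z : ℂ => z) (𝓝[Sg l G ν ρ] z) (𝓝 z) :=
    tendsto_id.mono_left nhdsWithin_le_nhds
  have i1 : 0 ≤ (z * af l G ρ z).im := by
    refine ge_of_tendsto ((Complex.continuous_im.tendsto _).comp (tz.mul ta)) ?_
    filter_upwards [self_mem_nhdsWithin] with w hw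
    exact hw.2.1.le
  have i2 : 0 ≤ (om l G ρ z).im := by
    refine ge_of_tendsto ((Complex.continuous_im.tendsto _).comp to') ?_
    filter_upwards [self_mem_nhdsWithin] with w hw
    exact hw.2.2.1.le
  have i3 : 0 ≤ (af l G ρ z * bf l G ρ z).im := by
    refine ge_of_tendsto ((Complex.continuous_im.tendsto _).comp (ta.mul tb)) ?_
    filter_upwards [self_mem_nhdsWithin] with w hw
    obtain ⟨w1, w2, w3, w4⟩ := hw
    obtain ⟨-, -, -, -, p, q⟩ := up_facts hl G ρ w1
    exact ab_im w1 p q w2 w3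
  obtain ⟨-, -, -, -, ia, ib⟩ := up_facts hl G ρ hz
  obtain ⟨na, nb⟩ := af_ne hl G ρ hD
  have hz0 : z ≠ 0 := by rintro rfl; simp at hz
  have hom0 : om l G ρ z ≠ 0 := mul_ne_zero (mul_ne_zero hz0 na) nb
  -- the limit is not a positive number
  have hpos : ∀ s : ℝ, 0 < s → om l G ρ z ≠ s := by
    intro s hs e
    have e2 : af l G ρ z * bf l G ρ z = s * (1 / z) := by
      rw [← e]; unfold om; field_simp
    rw [e2, Complex.im_ofReal_mul] at i3
    have := mul_pos hs (neg_pos.2 (im_inv_neg hz))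
    linarith
  have hDw : om l G ρ z ∉ posAxis := by
    rintro ⟨h1, h2⟩
    have e : om l G ρ z = ((om l G ρ z).re : ℂ) := Complex.ext (by simp) (by simpa using h1)
    rcases h2.eq_or_lt with h | h
    · exact hom0 (by rw [e, ← h]; simp)
    · exact hpos _ h e
  -- the identity extends
  have hev : (fun z => qf ν (om l G ρ z)) =ᶠ[𝓝 z] (fun z => qf ρ z - cf l G ρ z) := by
    refine ((lhs_an hl G ν ρ hD hDw).frequently_eq_iff_eventually_eq (rhs_an hl G ρ hD)).1 ?_
    have hzS : z ∉ Sg l G ν ρ := hnot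
    have h2 : ∃ᶠ w in 𝓝[≠] z, w ∈ Sg l G ν ρ := by
      have h3 : ∃ᶠ w in 𝓝 z, w ∈ Sg l G ν ρ := mem_closure_iff_frequently.1 hcl
      rw [frequently_nhdsWithin_iff]
      refine h3.mono fun w hw => ⟨hw, ?_⟩
      intro h; exact hzS (h ▸ hw)
    exact h2.mono fun w hw => hw.2.2.2.self_of_nhds
  rcases i2.eq_or_lt with hi | hi
  · -- real limit: impossible
    have hre : (om l G ρ z).re < 0 := by
      by_contra hcon
      exact hDw ⟨hi.symm, not_lt.1 hcon⟩
    have e : om l G ρ z = ((om l G ρ z).re : ℂ) := Complex.ext (by simp) (by simpa using hi.symm)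
    have hid : qf ν (om l G ρ z) = qf ρ z - cf l G ρ z := hev.self_of_nhds
    have hh := hf_om hl G ν ρ hD hid
    have hcc : cf l G ν (om l G ρ z) = cf l G ρ z := by unfold cf; rw [hh]
    obtain ⟨q, r, h', c, hq, hr, hh', hc, er, eh, e1, e2, e3, e4⟩ := neg_facts hl G ν hre
    rw [← e] at e1 e2 e3 e4
    have hqr : qf ρ z = ((q + c : ℝ) : ℂ) := by
      push_cast
      rw [← e1, ← e4, hid, hcc]; ring
    have hr' : rf l ρ z = ((1 - l + l * (q + c) : ℝ) : ℂ) := by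
      unfold rf; rw [hqr]; push_cast; ring
    have p1 := zqf_im_pos ρ hz
    have p2 := zrf_im_pos hl ρ hz
    rw [hqr, Complex.im_mul_ofReal] at p1
    rw [hr', Complex.im_mul_ofReal] at p2
    have q1 : 0 < q + c := (mul_pos_iff_of_pos_left hz).1 p1
    have q2 : 0 < 1 - l + l * (q + c) := (mul_pos_iff_of_pos_left hz).1 p2
    have e5 : (hf l ρ z).im = z.im * (q + c) * (1 - l + l * (q + c)) := by
      unfold hf; rw [hqr, hr', Complex.im_mul_ofReal, Complex.im_mul_ofReal]
    rw [← hh, e3, Complex.ofReal_im] at e5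
    have := mul_pos (mul_pos hz q1) q2
    linarith
  · apply hnot
    refine ⟨hz, ?_, hi, hev⟩
    rcases i1.eq_or_lt with h | h
    · exfalso
      set s := (z * af l G ρ z).re with hs
      have e : z * af l G ρ z = (s : ℂ) := Complex.ext (by simp [hs]) (by simpa using h.symm)
      have e2 : om l G ρ z = s * bf l G ρ z := by unfold om; rw [e]
      rw [e2, Complex.im_ofReal_mul] at hi
      have hs0 : 0 < s := by
        by_contra hcon
        have := mul_nonpos_of_nonpos_of_nonneg (not_lt.1 hcon) ib
        linarith
      have e3 : af l G ρ z = s * (1 / z) := by rw [← e]; field_simp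
      rw [e3, Complex.im_ofReal_mul] at ia
      have := mul_pos hs0 (neg_pos.2 (im_inv_neg hz))
      linarith
    · exact h

lemma Sg_start {l : ℝ} (hl : l ∈ Set.Ioo (0 : ℝ) 1) (G ν ρ : Measure ℝ) [IsFiniteMeasure G]
    [IsProbabilityMeasure ρ] [IsProbabilityMeasure ν] (hconv : IsRectConv l G ν ρ) :
    ({z : ℂ | 0 < z.im} ∩ Sg l G ν ρ).Nonempty := by
  obtain ⟨ε, hε, hc⟩ := hconv
  obtain ⟨ta, tb⟩ := limits l G ρ
  have to' := om_tendsto l G ρ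
  have hre : ∀ᶠ z in 𝓝[Sec] 0, (om l G ρ z).re < 0 := to' self_mem_nhdsWithin
  rw [eventually_nhdsWithin_iff, Metric.eventually_nhds_iff_ball] at hre
  obtain ⟨r, hr, hre⟩ := hre
  set U : Set ℂ := Metric.ball 0 r ∩ Sec with hU
  have hUc : IsPreconnected U := ((convex_ball (0 : ℂ) r).inter Sec_convex).isPreconnected
  have hSo : IsOpen Sec :=
    isOpen_lt Complex.continuous_im.abs Complex.continuous_re.neg
  have hUD : ∀ z ∈ U, z ∉ posAxis := fun z hz => notMem_of_re (Sec_re hz.2)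
  have hUw : ∀ z ∈ U, om l G ρ z ∉ posAxis := fun z hz => notMem_of_re (hre z hz.1 hz.2)
  have hL : AnalyticOnNhd ℂ (fun z => qf ν (om l G ρ z)) U :=
    fun z hz => lhs_an hl G ν ρ (hUD z hz) (hUw z hz)
  have hR : AnalyticOnNhd ℂ (fun z => qf ρ z - cf l G ρ z) U :=
    fun z hz => rhs_an hl G ρ (hUD z hz)
  -- base point
  set d := min ε r / 2 with hd
  have hd0 : 0 < d := by have := lt_min hε hr; positivity
  have hdε : d < ε := by have := min_le_left ε r; linarith
  have hdr : d < r := by have := min_le_right ε r; linarith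
  have hbase : ((-d : ℝ) : ℂ) ∈ U := by
    constructor
    · rw [Metric.mem_ball, dist_zero_right, Complex.norm_real, Real.norm_eq_abs, abs_neg,
        abs_of_pos hd0]
      exact hdr
    · simp [Sec, hd0]
  have hfreq : ∃ᶠ z in 𝓝[≠] ((-d : ℝ) : ℂ), qf ν (om l G ρ z) = qf ρ z - cf l G ρ z := by
    have h1 : Tendsto (fun x : ℝ => (x : ℂ)) (𝓝[≠] (-d)) (𝓝[≠] ((-d : ℝ) : ℂ)) := by
      refine tendsto_nhdsWithin_iff.2 ⟨(Complex.continuous_ofReal.tendsto _).mono_left nhdsWithin_le_nhds, ?_⟩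
      filter_upwards [self_mem_nhdsWithin] with x hx
      have hx : x ≠ -d := hx
      simpa using fun h : (x : ℂ) = -(d : ℂ) => hx (by exact_mod_cast h)
    refine h1.frequently ?_
    refine Filter.Eventually.frequently ?_
    have h2 : Set.Ioo (-ε) 0 ∈ 𝓝 (-d) := Ioo_mem_nhds (by linarith) (by linarith)
    filter_upwards [nhdsWithin_le_nhds h2] with x hx
    exact ident_neg hl G ν ρ hx.2 (hc x hx).2
  have hEq : Set.EqOn (fun z => qf ν (om l G ρ z)) (fun z => qf ρ z - cf l G ρ z) U :=
    hL.eqOn_of_preconnected_of_frequently_eq hR hUc hbase hfreq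
  -- the path
  have hpath : Tendsto (fun s : ℝ => (s : ℂ) * (-2 + Complex.I)) (𝓝[>] 0) (𝓝[Sec] 0) := by
    refine tendsto_nhdsWithin_iff.2 ⟨?_, ?_⟩
    · have : Tendsto (fun s : ℝ => (s : ℂ) * (-2 + Complex.I)) (𝓝 0) (𝓝 (((0 : ℝ) : ℂ) * (-2 + Complex.I))) :=
        (Complex.continuous_ofReal.mul continuous_const).tendsto 0
      simpa using this.mono_left nhdsWithin_le_nhds
    · filter_upwards [self_mem_nhdsWithin] with s hs
      have hs : 0 < s := hs
      simp only [Sec, Set.mem_ofPred_eq, Complex.im_ofReal_mul, Complex.re_ofReal_mul]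
      simp [abs_of_pos hs]
      linarith
  have hdir : ∀ f : ℂ → ℂ, Tendsto f (𝓝[Sec] 0) (𝓝 1) →
      ∀ᶠ s : ℝ in 𝓝[>] 0, 0 < ((s : ℂ) * (-2 + Complex.I) * f ((s : ℂ) * (-2 + Complex.I))).im := by
    intro f hf
    have h1 : Tendsto (fun s : ℝ => ((-2 + Complex.I) * f ((s : ℂ) * (-2 + Complex.I))).im)
        (𝓝[>] 0) (𝓝 (((-2 + Complex.I) * 1).im)) :=
      (Complex.continuous_im.tendsto _).comp ((hf.comp hpath).const_mul (-2 + Complex.I))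
    have h2 : (0 : ℝ) < ((-2 + Complex.I) * 1).im := by simp
    filter_upwards [h1.eventually (lt_mem_nhds h2), self_mem_nhdsWithin] with s hs hs0
    rw [mul_assoc, Complex.im_ofReal_mul]
    exact mul_pos hs0 hs
  have tab : Tendsto (fun z => af l G ρ z * bf l G ρ z) (𝓝[Sec] 0) (𝓝 1) := by
    simpa using ta.mul tb
  have hUev : ∀ᶠ z in 𝓝[Sec] (0 : ℂ), z ∈ U := by
    filter_upwards [self_mem_nhdsWithin, nhdsWithin_le_nhds (Metric.ball_mem_nhds (0 : ℂ) hr)]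
      with z h1 h2
    exact ⟨h2, h1⟩
  obtain ⟨s, s1, s2, s3, s4⟩ := ((hdir _ ta).and ((hdir _ tab).and
    ((hpath.eventually hUev).and self_mem_nhdsWithin))).exists
  have s4 : 0 < s := s4
  have hi : 0 < ((s : ℂ) * (-2 + Complex.I)).im := by
    rw [Complex.im_ofReal_mul]; simpa using s4
  refine ⟨(s : ℂ) * (-2 + Complex.I), hi, hi, s1, ?_, ?_⟩
  · unfold om; rw [mul_assoc]; exact s2
  · filter_upwards [(Metric.isOpen_ball.inter hSo).mem_nhds s3] with w hw
    exact hEq hw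

lemma Sg_all {l : ℝ} (hl : l ∈ Set.Ioo (0 : ℝ) 1) (G ν ρ : Measure ℝ) [IsFiniteMeasure G]
    [IsProbabilityMeasure ρ] [IsProbabilityMeasure ν] (hconv : IsRectConv l G ν ρ)
    {z : ℂ} (hz : 0 < z.im) : z ∈ Sg l G ν ρ := by
  have hc : IsPreconnected {z : ℂ | 0 < z.im} := (convex_halfSpace_im_gt 0).isPreconnected
  exact hc.subset_of_closure_inter_subset (Sg_open hl G ν ρ) (Sg_start hl G ν ρ hconv)
    (Sg_closed hl G ν ρ) hz

lemma om_D {l : ℝ} (hl : l ∈ Set.Ioo (0 : ℝ) 1) (G ν ρ : Measure ℝ) [IsFiniteMeasure G]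
    [IsProbabilityMeasure ρ] [IsProbabilityMeasure ν] (hconv : IsRectConv l G ν ρ)
    {z : ℂ} (hz : z ∉ posAxis) :
    om l G ρ z ∉ posAxis ∧ qf ν (om l G ρ z) = qf ρ z - cf l G ρ z := by
  rcases D_cases hz with h | h | ⟨x, hx, rfl⟩
  · obtain ⟨-, -, h1, h2⟩ := Sg_all hl G ν ρ hconv h
    exact ⟨notMem_of_im h1.ne', h2.self_of_nhds⟩
  · obtain ⟨-, -, h1, h2⟩ := Sg_all hl G ν ρ hconv h
    have h3 := h2.self_of_nhds
    simp only [om_conj, qf_conj, cf_conj, ← map_sub] at h3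
    refine ⟨?_, (starRingEnd ℂ).injective h3⟩
    rw [om_conj] at h1
    exact conj_notMem (notMem_of_im h1.ne')
  · obtain ⟨w, hw, ew⟩ := om_neg hl G ρ hx
    have hDw : om l G ρ x ∉ posAxis := by rw [ew]; exact notMem_of_re (by simpa using hw)
    refine ⟨hDw, ?_⟩
    have hne : (𝓝[{z : ℂ | 0 < z.im}] (x : ℂ)).NeBot := by
      rw [← mem_closure_iff_nhdsWithin_neBot, Complex.closure_setOf_lt_im]
      simp
    have t1 := (lhs_an hl G ν ρ hz hDw).continuousAt.tendsto.mono_left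
      (nhdsWithin_le_nhds (s := {z : ℂ | 0 < z.im}))
    have t2 := (rhs_an hl G ρ hz).continuousAt.tendsto.mono_left
      (nhdsWithin_le_nhds (s := {z : ℂ | 0 < z.im}))
    refine tendsto_nhds_unique_of_eventuallyEq t1 t2 ?_
    filter_upwards [self_mem_nhdsWithin] with w hw
    exact (Sg_all hl G ν ρ hconv hw).2.2.2.self_of_nhds

lemma arg_le_of {z u : ℂ} (hz : 0 < z.im) (hu0 : u ≠ 0) (hu : 0 ≤ u.im) (h : 0 < (z * u).im) :
    Complex.arg z ≤ Complex.arg (z * u) := by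
  have hz0 : z ≠ 0 := by rintro rfl; simp at hz
  have a1 : 0 ≤ Complex.arg z := Complex.arg_nonneg_iff.2 hz.le
  have a2 : 0 ≤ Complex.arg u := Complex.arg_nonneg_iff.2 hu
  have a3 : Complex.arg z < Real.pi := Complex.arg_lt_pi_iff.2 (Or.inr hz.ne')
  have a4 := Complex.arg_le_pi u
  by_cases hs : Complex.arg z + Complex.arg u ≤ Real.pi
  · rw [Complex.arg_mul hz0 hu0 ⟨by linarith [Real.pi_pos], hs⟩]
    linarith
  · exfalso
    push Not at hs
    have e : (z * u).im = ‖z‖ * ‖u‖ * Real.sin (Complex.arg z + Complex.arg u) := by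
      rw [Real.sin_add, Complex.mul_im]
      have b1 := Complex.norm_mul_cos_arg z
      have b2 := Complex.norm_mul_sin_arg z
      have b3 := Complex.norm_mul_cos_arg u
      have b4 := Complex.norm_mul_sin_arg u
      rw [← b1, ← b2, ← b3, ← b4]
      simp only [b1, b2, b3, b4]
      nth_rewrite 1 [← b1]
      nth_rewrite 1 [← b2]
      nth_rewrite 1 [← b3]
      nth_rewrite 1 [← b4]
      ring
    have hsin : Real.sin (Complex.arg z + Complex.arg u) < 0 := by
      have := Real.sin_pos_of_pos_of_lt_pi (x := Complex.arg z + Complex.arg u - Real.pi)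
        (by linarith) (by linarith)
      rw [Real.sin_sub_pi] at this
      linarith
    have := mul_pos (norm_pos_iff.2 hz0) (norm_pos_iff.2 hu0)
    have := mul_neg_of_pos_of_neg this hsin
    linarith

/-- Subordination for the rectangular free convolution: the function
`ω₂(z) = H_ρ(z)/T(M_ρ(z) - C(H_ρ(z)))` (defined near `0⁻`) extends to an analytic self-map
of `ℂ∖[0,∞)` with `H_ν ∘ ω₂ = H_ρ`, commuting with conjugation, tending to `0` at `0⁻`,
injective (a right inverse of `k(w) = H_ν(w)/T(C(H_ν(w)) + M_ν(w))`), and increasing the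
argument on `ℂ⁺`. -/
theorem stmt12 (l : ℝ) (hl : l ∈ Set.Ioo (0 : ℝ) 1)
    (μ : Measure ℝ) [IsProbabilityMeasure μ]
    (hμsym : Measure.map (fun t : ℝ => -t) μ = μ)
    (G : Measure ℝ) [IsFiniteMeasure G]
    (hGsym : Measure.map (fun t : ℝ => -t) G = G)
    (hID : IsRectInfDiv l μ G)
    (ν ρ : Measure ℝ) [IsProbabilityMeasure ν] [IsProbabilityMeasure ρ]
    (hνsym : Measure.map (fun t : ℝ => -t) ν = ν)
    (hρsym : Measure.map (fun t : ℝ => -t) ρ = ρ)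
    (hconv : IsRectConv l G ν ρ) :
    ∃ ω₂ : ℂ → ℂ,
      AnalyticOnNhd ℂ ω₂ {z : ℂ | z ∉ posAxis} ∧
      (∀ z : ℂ, z ∉ posAxis → ω₂ z ∉ posAxis) ∧
      (∀ᶠ x : ℝ in nhdsWithin (0 : ℝ) (Set.Iio (0 : ℝ)),
        ω₂ (x : ℂ) = Ht l ρ (x : ℂ) / Tfun l (Mt ρ (x : ℂ) - rectC G (Ht l ρ (x : ℂ)))) ∧
      (∀ z : ℂ, z ∉ posAxis → Ht l ν (ω₂ z) = Ht l ρ z) ∧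
      (∀ z : ℂ, z ∉ posAxis → ω₂ (starRingEnd ℂ z) = starRingEnd ℂ (ω₂ z)) ∧
      Tendsto (fun x : ℝ => ω₂ (x : ℂ)) (nhdsWithin (0 : ℝ) (Set.Iio (0 : ℝ)))
        (nhds (0 : ℂ)) ∧
      Set.InjOn ω₂ {z : ℂ | z ∉ posAxis} ∧
      (∀ z : ℂ, z ∉ posAxis →
        Ht l ν (ω₂ z) / Tfun l (rectC G (Ht l ν (ω₂ z)) + Mt ν (ω₂ z)) = z) ∧
      (∀ z ∈ UHP, Complex.arg z ≤ Complex.arg (ω₂ z) ∧ Complex.arg (ω₂ z) < Real.pi) := by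
  have e1 : ∀ z : ℂ, z ∉ posAxis → Ht l ν (om l G ρ z) = Ht l ρ z := by
    intro z hz
    obtain ⟨h1, h2⟩ := om_D hl G ν ρ hconv hz
    rw [Ht_eq l ν h1, Ht_eq l ρ hz, hf_om hl G ν ρ hz h2]
  have e2 : ∀ z : ℂ, z ∉ posAxis →
      Ht l ν (om l G ρ z) / Tfun l (rectC G (Ht l ν (om l G ρ z)) + Mt ν (om l G ρ z)) = z := by
    intro z hz
    obtain ⟨h1, h2⟩ := om_D hl G ν ρ hconv hz
    obtain ⟨-, n1, n2, -, -⟩ := D_facts hl G ρ hz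
    rw [e1 z hz, Mt_eq ν h1, h2, Ht_eq l ρ hz]
    have h3 : Tfun l (rectC G (hf l ρ z) + (qf ρ z - cf l G ρ z - 1)) = qf ρ z * rf l ρ z := by
      unfold Tfun cf rf; ring
    rw [h3]
    unfold hf
    rw [mul_assoc, mul_div_cancel_right₀ _ (mul_ne_zero n1 n2)]
  refine ⟨om l G ρ, analytic_D fun z hz => om_diff hl G ρ hz,
    fun z hz => (om_D hl G ν ρ hconv hz).1, ?_, e1, fun z _ => om_conj l G ρ z, ?_, ?_, e2, ?_⟩
  · filter_upwards [self_mem_nhdsWithin] with x hx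
    have hx : x < 0 := hx
    exact (om_eq l G ρ (notMem_of_re (by simpa using hx))).symm
  · exact ((om_tendsto l G ρ).comp ofReal_Sec).mono_right nhdsWithin_le_nhds
  · intro z hz w hw h
    have h1 := e2 z hz
    have h2 := e2 w hw
    rw [← h1, ← h2, h]
  · intro z hz
    have hz : 0 < z.im := hz
    obtain ⟨-, h1, h2, -⟩ := Sg_all hl G ν ρ hconv hz
    obtain ⟨-, -, -, -, p, q⟩ := up_facts hl G ρ hz
    obtain ⟨na, nb⟩ := af_ne hl G ρ (notMem_of_im hz.ne')
    refine ⟨?_, Complex.arg_lt_pi_iff.2 (Or.inr h2.ne')⟩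
    have h3 := ab_im hz p q h1 h2
    unfold om at h2 ⊢
    rw [mul_assoc] at h2 ⊢
    exact arg_le_of hz (mul_ne_zero na nb) h3 h2

end
end
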